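/- arXiv:2511.14551 — 4 statements merged into one kernel-verified Lean document; each statement's English description precedes it below -/
import Mathlib

section
/- There exists a finite universal constant C such that the following holds. Let X be a real random variable on a probability space with E[|X|^m] < ∞ for every integer m ≥ 1 and E[X] = 0. Let J ≥ 1 be an integer, let γ_1,…,γ_J ∈ [0,∞), and let H_j, Δ_j ∈ (0,∞) for 1 ≤ j ≤ J. Assume that for every integer m ≥ 2, |κ_m(X)| ≤ ∑_{j=1}^J (m!/2)^{1+γ_j} H_j / Δ_j^{m−2}. Then, setting α_j := 1/(1+γ_j), for every x > 0: P(X ≥ x) ≤ C · max_{1≤j≤J} exp( − (1/(2J)) · x² / ( H_j + x^{2−α_j} / Δ_j^{α_j} ) ). -/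
open MeasureTheory Finset

/-- The `m`-th cumulant `κ_m(X)` of a real random variable `X`, defined
combinatorially: `κ_m(X) = ∑_{σ∈Π[m]} (−1)^{|σ|−1}(|σ|−1)! ∏_{b∈σ} E[X^{|b|}]`. -/
noncomputable def cumulantM {Ω : Type*} [MeasurableSpace Ω] (μ : Measure Ω)
    (X : Ω → ℝ) (m : ℕ) : ℝ :=
  ∑ σ : Finpartition (Finset.univ : Finset (Fin m)),
    (-1 : ℝ) ^ (σ.parts.card - 1) * (Nat.factorial (σ.parts.card - 1) : ℝ) *
      ∏ b ∈ σ.parts, ∫ ω, X ω ^ b.card ∂μ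


lemma fp_sum_insert {α : Type*} [DecidableEq α] (F : Finset (Finset α) → ℝ) (a : α) (s : Finset α)
    (ha : a ∉ s) :
    ∑ P : Finpartition (insert a s), F P.parts =
      ∑ t ∈ s.powerset, ∑ Q : Finpartition (s \ t), F (insert (insert a t) Q.parts) := by
  rw [Finset.sum_sigma']
  symm
  have key : ∀ x : (Σ t : Finset α, Finpartition (s \ t)),
      x ∈ s.powerset.sigma (fun t => (univ : Finset (Finpartition (s \ t)))) →
      (s \ x.1) ⊔ (insert a x.1) = insert a s := by
    intro x hx
    have hx' : x.1 ⊆ s := by simpa using hx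
    ext y
    simp only [Finset.sup_eq_union, Finset.mem_union, Finset.mem_sdiff, Finset.mem_insert]
    have := @hx' y
    tauto
  have keyd : ∀ x : (Σ t : Finset α, Finpartition (s \ t)),
      Disjoint (s \ x.1) (insert a x.1) := by
    intro x
    rw [Finset.disjoint_left]
    intro y hy
    simp only [Finset.mem_sdiff] at hy
    simp only [Finset.mem_insert, not_or]
    exact ⟨fun h => ha (h ▸ hy.1), hy.2⟩
  refine Finset.sum_bij (fun x hx => x.2.extend (b := insert a x.1) (by simp) (keyd x) (key x hx))
    (fun _ _ => Finset.mem_univ _) ?_ ?_ ?_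
  · rintro ⟨t, Q⟩ hx ⟨t', Q'⟩ hx' h
    have hp : insert (insert a t) Q.parts = insert (insert a t') Q'.parts :=
      congrArg Finpartition.parts h
    have hts : t ⊆ s := by simpa using hx
    have hts' : t' ⊆ s := by simpa using hx'
    have hQ : ∀ b ∈ Q.parts, a ∉ b := fun b hb hab => by
      have := Q.le hb hab
      simp [ha] at this
    have hQ' : ∀ b ∈ Q'.parts, a ∉ b := fun b hb hab => by
      have := Q'.le hb hab
      simp [ha] at this
    have h1 : insert a t ∈ insert (insert a t') Q'.parts := by rw [← hp]; simp
    rw [Finset.mem_insert] at h1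
    have h2 : insert a t = insert a t' := by
      rcases h1 with h1 | h1
      · exact h1
      · exact absurd (Finset.mem_insert_self a t) (hQ' _ h1)
    have h3 : t = t' := by
      have := congrArg (fun u => u.erase a) h2
      simpa [Finset.erase_insert (fun h => ha (hts h)),
        Finset.erase_insert (fun h => ha (hts' h))] using this
    subst h3
    congr 1
    have := congrArg (fun u => u.erase (insert a t)) hp
    rw [Finset.erase_insert (fun h => hQ _ h (Finset.mem_insert_self a t)),
      Finset.erase_insert (fun h => hQ' _ h (Finset.mem_insert_self a t))] at this
    exact Finpartition.ext this
  · intro P _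
    have haS : a ∈ insert a s := Finset.mem_insert_self a s
    have hap : a ∈ P.part a := P.mem_part_self.2 haS
    have hpm : P.part a ∈ P.parts := P.part_mem.2 haS
    have hsub : (P.part a).erase a ⊆ s := by
      intro y hy
      rw [Finset.mem_erase] at hy
      have := P.part_subset a hy.2
      simpa [hy.1] using this
    have hsup : (P.parts.erase (P.part a)).sup id = s \ (P.part a).erase a := by
      ext y
      rw [Finset.mem_sup]
      simp only [Finset.mem_erase, id, Finset.mem_sdiff, not_and]
      constructor
      · rintro ⟨v, ⟨hv1, hv2⟩, hy⟩
        have hya : y ≠ a := by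
          rintro rfl
          exact hv1 (P.part_eq_of_mem hv2 hy).symm
        refine ⟨by simpa [hya] using P.le hv2 hy, fun _ hy' => ?_⟩
        exact hv1 (P.eq_of_mem_parts hv2 hpm hy hy')
      · rintro ⟨hy, hy'⟩
        have hya : y ≠ a := by rintro rfl; exact ha hy
        obtain ⟨v, hv, hyv⟩ := P.exists_mem (Finset.mem_insert_of_mem hy)
        exact ⟨v, ⟨by rintro rfl; exact hy' hya hyv, hv⟩, hyv⟩
    refine ⟨⟨(P.part a).erase a, P.ofSubset (Finset.erase_subset (P.part a) P.parts) hsup⟩,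
      by simpa using hsub, ?_⟩
    apply Finpartition.ext
    show insert (insert a ((P.part a).erase a)) (P.parts.erase (P.part a)) = P.parts
    rw [Finset.insert_erase hap, Finset.insert_erase hpm]
  · intro x hx
    rfl

noncomputable def egf (a : ℕ → ℝ) : PowerSeries ℝ :=
  PowerSeries.mk fun n => if n = 0 then 0 else a n / n.factorial

noncomputable def fpT {α : Type*} [DecidableEq α] (a : ℕ → ℝ) (k : ℕ) (s : Finset α) : ℝ :=
  ∑ P : Finpartition s, if P.parts.card = k then ∏ b ∈ P.parts, a b.card else 0

lemma fpT_succ_insert {α : Type*} [DecidableEq α] (a : ℕ → ℝ) (k : ℕ) (s : Finset α) (x : α)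
    (hx : x ∉ s) : fpT a (k+1) (insert x s) = ∑ t ∈ s.powerset, a (t.card + 1) * fpT a k (s \ t) := by
  unfold fpT
  rw [fp_sum_insert (fun p => if p.card = k + 1 then ∏ b ∈ p, a b.card else 0) x s hx]
  refine Finset.sum_congr rfl fun t ht => ?_
  rw [Finset.mul_sum]
  refine Finset.sum_congr rfl fun Q _ => ?_
  have hQ : insert x t ∉ Q.parts := fun hb => by
      have := Q.le hb (Finset.mem_insert_self x t)
      simp [hx] at this
  have hxt : x ∉ t := fun h => hx (Finset.mem_powerset.1 ht h)
  rw [Finset.card_insert_of_notMem hQ, Finset.prod_insert hQ, Finset.card_insert_of_notMem hxt]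
  simp

lemma fpT_empty {α : Type*} [DecidableEq α] (a : ℕ → ℝ) (k : ℕ) :
    fpT a k (∅ : Finset α) = if k = 0 then 1 else 0 := by
  have : Unique (Finpartition (∅ : Finset α)) := inferInstanceAs (Unique (Finpartition (⊥ : Finset α)))
  unfold fpT
  rw [Fintype.sum_unique]
  have : (default : Finpartition (∅ : Finset α)).parts = ∅ :=
    Finpartition.parts_eq_empty_iff.2 rfl
  rw [this]
  simp [eq_comm]

lemma fpT_eq {α : Type*} [DecidableEq α] (a : ℕ → ℝ) (k : ℕ) (s : Finset α) :
    (k.factorial : ℝ) * fpT a k s = s.card.factorial * PowerSeries.coeff s.card (egf a ^ k) := by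
  induction k generalizing s with
  | zero =>
    rcases s.eq_empty_or_nonempty with rfl | hs
    · simp [fpT_empty]
    · simp only [pow_zero, PowerSeries.coeff_one, hs.card_pos.ne', if_false, fpT]
      rw [Finset.sum_eq_zero]
      · simp
      intro P _
      rw [if_neg]
      exact (Finset.card_pos.2 (P.parts_nonempty hs.ne_empty)).ne'
  | succ k ih =>
    rcases s.eq_empty_or_nonempty with rfl | hs
    · have : PowerSeries.coeff 0 (egf a) = 0 := by simp [egf]
      rw [PowerSeries.coeff_zero_eq_constantCoeff_apply] at this
      simp [fpT_empty, this]
    · obtain ⟨x, hx⟩ := hs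
      obtain ⟨s', hxs, rfl⟩ : ∃ s', x ∉ s' ∧ s = insert x s' :=
        ⟨s.erase x, by simp, (Finset.insert_erase hx).symm⟩
      rw [fpT_succ_insert a k s' x hxs, Finset.card_insert_of_notMem hxs]
      have h1 := PowerSeries.coeff_derivative (egf a ^ (k+1)) s'.card
      have h2 : (PowerSeries.derivative ℝ) (egf a ^ (k+1)) =
        ((k + 1 : ℕ) : PowerSeries ℝ) * ((PowerSeries.derivative ℝ (egf a)) * egf a ^ k) := by
        rw [PowerSeries.derivative_pow]; simp; ring
      rw [h2, ← nsmul_eq_mul, map_nsmul, PowerSeries.coeff_mul,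
        Finset.Nat.sum_antidiagonal_eq_sum_range_succ_mk] at h1
      have h3 : ∑ t ∈ s'.powerset, a (t.card + 1) * ((k.factorial : ℝ) * fpT a k (s' \ t)) =
        ∑ t ∈ s'.powerset, (fun i => a (i + 1) * ((s'.card - i).factorial *
          PowerSeries.coeff (s'.card - i) (egf a ^ k))) t.card := by
        refine Finset.sum_congr rfl fun t ht => ?_
        rw [ih, Finset.card_sdiff_of_subset (Finset.mem_powerset.1 ht)]
      rw [Finset.sum_powerset_apply_card (fun i => a (i + 1) * ((s'.card - i).factorial *
          PowerSeries.coeff (s'.card - i) (egf a ^ k)))] at h3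
      have h4 : (((k+1).factorial : ℕ) : ℝ) * ∑ t ∈ s'.powerset, a (t.card + 1) * fpT a k (s' \ t)
        = (k+1) * ∑ t ∈ s'.powerset, a (t.card + 1) * ((k.factorial : ℝ) * fpT a k (s' \ t)) := by
        rw [Nat.factorial_succ, Finset.mul_sum, Finset.mul_sum]
        refine Finset.sum_congr rfl fun t ht => ?_
        push_cast; ring
      rw [h4, h3, Nat.factorial_succ]
      push_cast
      rw [show ∀ p q r : ℝ, p * q * r = q * (r * p) by intros; ring, ← h1]
      simp only [nsmul_eq_mul, Finset.mul_sum]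
      refine Finset.sum_congr rfl fun i hi => ?_
      have hi' : i ≤ s'.card := Nat.lt_succ_iff.1 (Finset.mem_range.1 hi)
      rw [PowerSeries.coeff_derivative]
      simp only [egf, PowerSeries.coeff_mk]
      rw [Nat.choose_eq_factorial_div_factorial hi', Nat.cast_div
        (Nat.factorial_mul_factorial_dvd_factorial hi') (by positivity)]
      have e1 : (i.factorial : ℝ) ≠ 0 := by positivity
      have e2 : ((s'.card - i).factorial : ℝ) ≠ 0 := by positivity
      simp only [Nat.factorial_succ]
      push_cast
      field_simp

noncomputable def cumA (a : ℕ → ℝ) (m : ℕ) : ℝ :=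
  ∑ σ : Finpartition (Finset.univ : Finset (Fin m)),
    (-1 : ℝ) ^ (σ.parts.card - 1) * (Nat.factorial (σ.parts.card - 1) : ℝ) *
      ∏ b ∈ σ.parts, a b.card

noncomputable def logN (a : ℕ → ℝ) (N : ℕ) : PowerSeries ℝ :=
  ∑ k ∈ Finset.range N, ((-1 : ℝ) ^ k / (k + 1)) • egf a ^ (k + 1)

lemma cumA_eq (a : ℕ → ℝ) (m N : ℕ) (hm : 1 ≤ m) (hN : m ≤ N) :
    cumA a m = m.factorial * PowerSeries.coeff m (logN a N) := by
  have h1 : cumA a m = ∑ k ∈ Finset.range N, (-1 : ℝ) ^ k * k.factorial *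
      fpT a (k+1) (Finset.univ : Finset (Fin m)) := by
    unfold fpT cumA
    simp only [Finset.mul_sum]
    rw [Finset.sum_comm]
    refine Finset.sum_congr rfl fun P _ => ?_
    have hne : (Finset.univ : Finset (Fin m)) ≠ ⊥ := by
      have : Nonempty (Fin m) := ⟨⟨0, hm⟩⟩
      exact Finset.univ_nonempty.ne_empty
    have hpos := Finset.card_pos.2 (P.parts_nonempty hne)
    have hle := P.card_parts_le_card
    rw [Finset.card_univ, Fintype.card_fin] at hle
    rw [Finset.sum_eq_single (P.parts.card - 1)]
    · rw [if_pos (by omega)]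
    · intro b _ hb
      rw [if_neg (by omega), mul_zero]
    · intro h
      exact absurd (Finset.mem_range.2 (by omega)) h
  rw [h1, logN, map_sum, Finset.mul_sum]
  refine Finset.sum_congr rfl fun k _ => ?_
  have h2 := fpT_eq a (k+1) (Finset.univ : Finset (Fin m))
  rw [Finset.card_univ, Fintype.card_fin] at h2
  rw [PowerSeries.coeff_smul, smul_eq_mul]
  rw [show ∀ p q r : ℝ, p * (q * r) = q * (p * r) by intros; ring, ← h2, Nat.factorial_succ]
  push_cast
  have : (k : ℝ) + 1 ≠ 0 := by positivity
  field_simp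

lemma deriv_logN (a : ℕ → ℝ) (N : ℕ) :
    PowerSeries.derivative ℝ (logN a N) * (1 + egf a) =
      PowerSeries.derivative ℝ (egf a) * (1 - (- egf a) ^ N) := by
  have h : PowerSeries.derivative ℝ (logN a N) =
      PowerSeries.derivative ℝ (egf a) * ∑ k ∈ Finset.range N, (- egf a) ^ k := by
    unfold logN
    rw [map_sum, Finset.mul_sum]
    refine Finset.sum_congr rfl fun k _ => ?_
    rw [Derivation.map_smul, PowerSeries.derivative_pow]
    have e : ((-1 : ℝ) ^ k / (k + 1)) • (((k + 1 : ℕ) : PowerSeries ℝ)) = (-1) ^ k := by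
      have : (((k + 1 : ℕ) : PowerSeries ℝ)) = PowerSeries.C (((k + 1 : ℕ) : ℝ)) := by simp
      rw [this, PowerSeries.smul_eq_C_mul, ← map_mul]
      have e2 : (-1 : ℝ) ^ k / (k + 1) * ((k + 1 : ℕ) : ℝ) = (-1) ^ k := by
        push_cast
        have : (k : ℝ) + 1 ≠ 0 := by positivity
        field_simp
      rw [e2]; simp
    rw [← smul_mul_assoc, ← smul_mul_assoc, e, neg_pow]
    simp only [Nat.add_sub_cancel]
    ring
  have g := mul_neg_geom_sum (- egf a) N
  rw [h, ← g]; ring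

lemma moment_rec (a : ℕ → ℝ) (h0 : a 0 = 1) (n : ℕ) :
    (n + 1 : ℝ) * (a (n + 1) / (n+1).factorial) =
      ∑ i ∈ Finset.range (n+1), ((i + 1 : ℝ) * (cumA a (i+1) / (i+1).factorial)) *
        (a (n - i) / (n - i).factorial) := by
  have h := congrArg (PowerSeries.coeff n) (deriv_logN a (n+1))
  rw [mul_sub, mul_one, map_sub] at h
  have hX : PowerSeries.X ∣ egf a := by
    rw [PowerSeries.X_dvd_iff, ← PowerSeries.coeff_zero_eq_constantCoeff_apply]; simp [egf]
  have hz : PowerSeries.coeff n (PowerSeries.derivative ℝ (egf a) * (- egf a) ^ (n+1)) = 0 := by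
    have : PowerSeries.X ^ (n+1) ∣ PowerSeries.derivative ℝ (egf a) * (- egf a) ^ (n+1) :=
      Dvd.dvd.mul_left (pow_dvd_pow_of_dvd ((dvd_neg).2 hX) _) _
    exact PowerSeries.X_pow_dvd_iff.1 this n (Nat.lt_succ_self n)
  rw [hz, sub_zero, PowerSeries.coeff_mul, Finset.Nat.sum_antidiagonal_eq_sum_range_succ_mk,
    PowerSeries.coeff_derivative] at h
  have e0 : PowerSeries.coeff (n+1) (egf a) = a (n+1) / (n+1).factorial := by simp [egf]
  rw [e0] at h
  rw [mul_comm, ← h]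
  refine Finset.sum_congr rfl fun i hi => ?_
  have hi' : i + 1 ≤ n + 1 := Nat.succ_le_of_lt (Finset.mem_range.1 hi)
  rw [PowerSeries.coeff_derivative, cumA_eq a (i+1) (n+1) (by omega) hi']
  have e1 : PowerSeries.coeff (n - i) (1 + egf a) = a (n-i) / (n-i).factorial := by
    rw [map_add, PowerSeries.coeff_one]
    by_cases hc : n - i = 0
    · simp [hc, egf, h0]
    · simp [hc, egf]
  simp only [e1]
  have : ((i+1).factorial : ℝ) ≠ 0 := by positivity
  field_simp


/-- truncated exponential -/
noncomputable def expT (n : ℕ) (y : ℝ) : ℝ := ∑ k ∈ Finset.range (n+1), y ^ k / k.factorial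

lemma hasDerivAt_expT (n : ℕ) (y : ℝ) : HasDerivAt (expT n) (expT n y - y ^ n / n.factorial) y := by
  have h : HasDerivAt (expT n)
      (∑ k ∈ Finset.range (n+1), ((k : ℝ) * y ^ (k-1)) / k.factorial) y := by
    unfold expT
    exact HasDerivAt.fun_sum fun k _ => (hasDerivAt_pow k y).div_const _
  convert h using 1
  rw [Finset.sum_range_succ', expT, Finset.sum_range_succ]
  simp only [Nat.cast_zero, zero_mul, zero_div, add_zero, add_sub_cancel_right]
  refine Finset.sum_congr rfl fun k _ => ?_
  rw [Nat.factorial_succ]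
  push_cast
  have : (k : ℝ) + 1 ≠ 0 := by positivity
  have : (k.factorial : ℝ) ≠ 0 := by positivity
  field_simp

lemma expT_nonneg (n : ℕ) (hn : Even n) (y : ℝ) : 0 ≤ expT n y := by
  rcases le_total 0 y with hy | hy
  · exact Finset.sum_nonneg fun k _ => by positivity
  have hd : ∀ z : ℝ, HasDerivAt (fun z => Real.exp (-z) * expT n z)
      (- (Real.exp (-z) * (z ^ n / n.factorial))) z := by
    intro z
    have h1 : HasDerivAt (fun z : ℝ => Real.exp (-z)) (-Real.exp (-z)) z := by
      simpa using (hasDerivAt_neg z).exp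
    have h2 := h1.mul (hasDerivAt_expT n z)
    refine h2.congr_deriv ?_
    ring
  have hanti : Antitone (fun z => Real.exp (-z) * expT n z) := by
    apply antitone_of_deriv_nonpos
    · intro z; exact (hd z).differentiableAt
    · intro z
      rw [(hd z).deriv]
      have := hn.pow_nonneg z
      have : 0 ≤ Real.exp (-z) * (z ^ n / n.factorial) := by positivity
      linarith
  have h2 := hanti hy
  have h3 : expT n 0 = 1 := by
    unfold expT; rw [Finset.sum_range_succ']; simp
  simp only [neg_zero, Real.exp_zero, h3, mul_one] at h2
  by_contra hc
  push Not at hc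
  have := mul_neg_of_pos_of_neg (Real.exp_pos (-y)) hc
  linarith

lemma expT_mono (n : ℕ) {y z : ℝ} (hy : 0 ≤ y) (hyz : y ≤ z) : expT n y ≤ expT n z := by
  unfold expT
  gcongr

lemma expT_lower (n : ℕ) (t : ℝ) (ht : 0 ≤ t) : (1 - t / (n + 1)) * Real.exp t ≤ expT n t := by
  have hs : HasSum (fun k : ℕ => t ^ k / k.factorial) (Real.exp t) := by
    rw [Real.exp_eq_exp_ℝ]; exact NormedSpace.expSeries_div_hasSum_exp t
  -- sum of k t^k/k! / (n+1)
  have hs2 : HasSum (fun k : ℕ => (k : ℝ) / (n+1) * (t ^ k / k.factorial)) (t / (n+1) * Real.exp t) := by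
    rw [← hasSum_nat_add_iff' 1]
    simp only [Finset.range_one, Finset.sum_singleton, Nat.cast_zero, zero_div, zero_mul, sub_zero]
    have e : (fun k : ℕ => ((k + 1 : ℕ) : ℝ) / (n+1) * (t ^ (k+1) / (k+1).factorial)) =
        fun k : ℕ => t / (n+1) * (t ^ k / k.factorial) := by
      funext k
      rw [Nat.factorial_succ]
      push_cast
      have : (k : ℝ) + 1 ≠ 0 := by positivity
      have : (k.factorial : ℝ) ≠ 0 := by positivity
      field_simp
      ring
    rw [e]
    exact hs.mul_left (t / (n+1))
  have hfin : HasSum (fun k : ℕ => if k ∈ Finset.range (n+1) then t ^ k / k.factorial else 0) (expT n t) := by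
    have := hasSum_sum_of_ne_finset_zero (L := SummationFilter.unconditional ℕ) (s := Finset.range (n+1))
      (f := fun k : ℕ => if k ∈ Finset.range (n+1) then t ^ k / (k.factorial : ℝ) else 0)
      (fun b hb => by simp only [hb, if_false])
    convert this using 1
    unfold expT
    exact Finset.sum_congr rfl fun k hk => by simp only [hk, if_true]
  have := hasSum_le (fun k => ?_) hs (hfin.add hs2)
  · linarith
  · have hp : 0 ≤ t ^ k / (k.factorial : ℝ) := by positivity
    split_ifs with hk
    · have : 0 ≤ (k : ℝ) / (n+1) * (t ^ k / k.factorial) := by positivity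
      linarith
    · have hk' : n + 1 ≤ k := by simpa using hk
      have : (1 : ℝ) ≤ (k : ℝ) / (n+1) := by
        rw [one_le_div (by positivity)]; exact_mod_cast hk'
      nlinarith

lemma exp_bound_of_rec (n : ℕ) (p c : ℕ → ℝ) (hp : ∀ k, 0 ≤ p k) (hc : ∀ k, 0 ≤ c k) (hp0 : p 0 = 1)
    (hrec : ∀ k, k < n → (k + 1 : ℝ) * p (k+1) ≤
      ∑ i ∈ Finset.range (k+1), ((i + 1 : ℝ) * c (i+1)) * p (k - i)) :
    ∑ k ∈ Finset.range (n+1), p k ≤ Real.exp (∑ i ∈ Finset.range n, c (i+1)) := by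
  set P : ℝ → ℝ := fun s => ∑ k ∈ Finset.range (n+1), p k * s ^ k with hP
  set Q : ℝ → ℝ := fun s => ∑ i ∈ Finset.range n, c (i+1) * s ^ (i+1) with hQ
  set P' : ℝ → ℝ := fun s => ∑ k ∈ Finset.range n, ((k + 1 : ℝ) * p (k+1)) * s ^ k with hP'
  set Q' : ℝ → ℝ := fun s => ∑ i ∈ Finset.range n, ((i + 1 : ℝ) * c (i+1)) * s ^ i with hQ'
  have dP : ∀ s, HasDerivAt P (P' s) s := by
    intro s
    have h : HasDerivAt P (∑ k ∈ Finset.range (n+1), p k * ((k : ℝ) * s ^ (k-1))) s :=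
      HasDerivAt.fun_sum fun k _ => (hasDerivAt_pow k s).const_mul _
    convert h using 1
    rw [Finset.sum_range_succ']
    simp only [Nat.cast_zero, zero_mul, mul_zero, add_zero, hP']
    refine Finset.sum_congr rfl fun k _ => ?_
    push_cast; ring
  have dQ : ∀ s, HasDerivAt Q (Q' s) s := by
    intro s
    have h : HasDerivAt Q (∑ i ∈ Finset.range n, c (i+1) * (((i+1 : ℕ) : ℝ) * s ^ (i+1-1))) s :=
      HasDerivAt.fun_sum fun k _ => (hasDerivAt_pow _ s).const_mul _
    convert h using 1
    refine Finset.sum_congr rfl fun k _ => ?_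
    push_cast; ring
  have hle : ∀ s, 0 ≤ s → P' s ≤ Q' s * P s := by
    intro s hs
    calc P' s ≤ ∑ k ∈ Finset.range n, ∑ i ∈ Finset.range (k+1),
          (((i + 1 : ℝ) * c (i+1)) * s ^ i) * (p (k - i) * s ^ (k - i)) := by
          refine Finset.sum_le_sum fun k hk => ?_
          have h := mul_le_mul_of_nonneg_right (hrec k (Finset.mem_range.1 hk)) (pow_nonneg hs k)
          refine h.trans (le_of_eq ?_)
          rw [Finset.sum_mul]
          refine Finset.sum_congr rfl fun i hi => ?_
          have : s ^ k = s ^ i * s ^ (k - i) := by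
            rw [← pow_add]; congr 1; have := Finset.mem_range.1 hi; omega
          rw [this]; ring
      _ = ∑ x ∈ (Finset.range n).sigma (fun k => Finset.range (k+1)),
            (((x.2 + 1 : ℝ) * c (x.2+1)) * s ^ x.2) * (p (x.1 - x.2) * s ^ (x.1 - x.2)) := by
          rw [Finset.sum_sigma]
      _ = ∑ y ∈ ((Finset.range n).sigma (fun k => Finset.range (k+1))).image
            (fun x => (x.2, x.1 - x.2)),
            (((y.1 + 1 : ℝ) * c (y.1+1)) * s ^ y.1) * (p y.2 * s ^ y.2) := by
          rw [Finset.sum_image]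
          rintro ⟨k, i⟩ hx ⟨k', i'⟩ hx' h
          simp only [Finset.coe_sigma, Set.mem_sigma_iff, Finset.mem_coe, Finset.mem_range] at hx hx'
          simp only [Prod.mk.injEq] at h
          obtain ⟨rfl, h2⟩ := h
          have : k = k' := by omega
          subst this; rfl
      _ ≤ ∑ y ∈ Finset.range n ×ˢ Finset.range (n+1),
            (((y.1 + 1 : ℝ) * c (y.1+1)) * s ^ y.1) * (p y.2 * s ^ y.2) := by
          refine Finset.sum_le_sum_of_subset_of_nonneg ?_ ?_
          · intro y hy
            simp only [Finset.mem_image, Finset.mem_sigma, Finset.mem_range] at hy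
            obtain ⟨x, hx, rfl⟩ := hy
            simp only [Finset.mem_product, Finset.mem_range]
            omega
          · intro y _ _
            have := hc (y.1+1); have := hp y.2
            positivity
      _ = Q' s * P s := by
          rw [Finset.sum_product, hQ', hP, Finset.sum_mul_sum]
  have dR : ∀ s, HasDerivAt (fun s => P s * Real.exp (-Q s))
      (P' s * Real.exp (-Q s) + P s * (Real.exp (-Q s) * -Q' s)) s := fun s =>
    (dP s).mul ((dQ s).neg.exp)
  have hanti : AntitoneOn (fun s => P s * Real.exp (-Q s)) (Set.Ici 0) := by
    apply antitoneOn_of_deriv_nonpos (convex_Ici 0)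
    · exact fun s _ => (dR s).continuousAt.continuousWithinAt
    · exact fun s _ => (dR s).differentiableAt.differentiableWithinAt
    · intro s hs
      rw [interior_Ici] at hs
      rw [(dR s).deriv]
      have := hle s (le_of_lt hs)
      have he := Real.exp_pos (-Q s)
      nlinarith
  have h := hanti (Set.mem_Ici.2 le_rfl) (Set.mem_Ici.2 zero_le_one) zero_le_one
  have hP0 : P 0 = 1 := by
    simp only [hP]; rw [Finset.sum_range_succ']; simp [hp0]
  have hQ0 : Q 0 = 0 := by simp [hQ]
  have hP1 : P 1 = ∑ k ∈ Finset.range (n+1), p k := by simp [hP]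
  have hQ1 : Q 1 = ∑ i ∈ Finset.range n, c (i+1) := by simp [hQ]
  simp only [hP0, hQ0, hP1, hQ1, neg_zero, Real.exp_zero, mul_one] at h
  rw [Real.exp_neg, ← div_eq_mul_inv, div_le_one (Real.exp_pos _)] at h
  exact h

lemma fact_half_le (k : ℕ) : ((k+2).factorial : ℝ) / 2 ≤ (((k : ℝ) + 5) / 2) ^ k := by
  induction k with
  | zero => norm_num [Nat.factorial]
  | succ k ih =>
    have hb := one_add_mul_le_pow (a := 1 / ((k : ℝ) + 5)) (by
      have : 0 ≤ 1 / ((k : ℝ) + 5) := by positivity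
      linarith) k
    have h1 : (((k : ℝ) + 6) / 2) ^ k = (((k : ℝ) + 5) / 2) ^ k * (1 + 1 / ((k : ℝ) + 5)) ^ k := by
      rw [← mul_pow]; congr 1; field_simp; ring
    have e : ((k + 1 + 2).factorial : ℝ) / 2 = ((k : ℝ) + 3) * (((k+2).factorial : ℝ) / 2) := by
      rw [show k + 1 + 2 = (k + 2) + 1 by ring, Nat.factorial_succ]; push_cast; ring
    have e2 : (((k + 1 : ℕ) : ℝ) + 5) / 2 = ((k : ℝ) + 6) / 2 := by push_cast; ring
    rw [e, e2, pow_succ, h1]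
    have h3 : (k : ℝ) + 3 ≤ (1 + 1 / ((k : ℝ) + 5)) ^ k * (((k : ℝ) + 6) / 2) := by
      have : (k : ℝ) + 3 ≤ (1 + (k : ℝ) * (1 / ((k : ℝ) + 5))) * (((k : ℝ) + 6) / 2) := by
        have hk : (0 : ℝ) ≤ k := by positivity
        have : (1 + (k : ℝ) * (1 / ((k : ℝ) + 5))) * (((k : ℝ) + 6) / 2) - ((k : ℝ) + 3)
          = k / (2 * (k + 5)) := by field_simp; ring
        have : 0 ≤ (k : ℝ) / (2 * (k + 5)) := by positivity
        linarith
      refine this.trans ?_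
      gcongr
    calc ((k : ℝ) + 3) * (((k+2).factorial : ℝ) / 2)
        ≤ ((1 + 1 / ((k : ℝ) + 5)) ^ k * (((k : ℝ) + 6) / 2)) * (((k : ℝ) + 5) / 2) ^ k := by gcongr
      _ = _ := by ring


lemma geo_bound (γ H Δ x h : ℝ) (hγ : 0 ≤ γ) (hH : 0 < H) (hΔ : 0 < Δ) (hx : 0 < x) (hh : 0 < h)
    (hle : h ≤ x / (H + x ^ (2 - 1 / (1 + γ)) / Δ ^ (1 / (1 + γ)))) (N : ℕ)
    (hN : ∀ i, i < N → ((i+2).factorial : ℝ) / 2 ≤ (h * x) ^ i) :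
    ∑ i ∈ Finset.range N, (((i+2).factorial : ℝ) / 2) ^ (1 + γ) * H / Δ ^ i *
      (h ^ (i+2) / (i+2).factorial) ≤
      h ^ 2 / 2 * (H + x ^ (2 - 1 / (1 + γ)) / Δ ^ (1 / (1 + γ))) := by
  set B := x ^ (2 - 1 / (1 + γ)) / Δ ^ (1 / (1 + γ)) with hB
  have hg : 0 < 1 + γ := by linarith
  have hBpos : 0 < B := by positivity
  have hD : 0 < H + B := by linarith
  set t := h * x with ht
  have htpos : 0 < t := by positivity
  set q := h * t ^ γ / Δ with hq
  have hqpos : 0 < q := by positivity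
  have hBp : B ^ (1 + γ) = x ^ (1 + 2 * γ) / Δ := by
    rw [hB, Real.div_rpow (by positivity) (by positivity), ← Real.rpow_mul hx.le,
      ← Real.rpow_mul hΔ.le]
    have e1 : (2 - 1 / (1 + γ)) * (1 + γ) = 1 + 2 * γ := by field_simp; ring
    have e2 : 1 / (1 + γ) * (1 + γ) = 1 := by field_simp
    rw [e1, e2, Real.rpow_one]
  have hqle : q ≤ B / (H + B) := by
    have ht2 : t ≤ x ^ 2 / (H + B) := by
      calc t ≤ x / (H + B) * x := by rw [ht]; gcongr
        _ = x ^ 2 / (H + B) := by ring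
    have h1 : q ≤ x / (H + B) * (x ^ 2 / (H + B)) ^ γ / Δ := by
      rw [hq]; gcongr
    have h2 : x / (H + B) * (x ^ 2 / (H + B)) ^ γ / Δ = (B / (H + B)) ^ (1 + γ) := by
      rw [Real.div_rpow hBpos.le hD.le, hBp, Real.div_rpow (by positivity) hD.le,
        Real.rpow_add hx, Real.rpow_add hD, Real.rpow_one, Real.rpow_one, Real.rpow_mul hx.le]
      norm_num
      field_simp
    have h3 : (B / (H + B)) ^ (1 + γ) ≤ (B / (H + B)) ^ (1 : ℝ) := by
      apply Real.rpow_le_rpow_of_exponent_ge (by positivity)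
      · rw [div_le_one hD]; linarith
      · linarith
    rw [Real.rpow_one] at h3
    linarith
  have hterm : ∀ i ∈ Finset.range N, (((i+2).factorial : ℝ) / 2) ^ (1 + γ) * H / Δ ^ i *
      (h ^ (i+2) / (i+2).factorial) ≤ h ^ 2 / 2 * H * q ^ i := by
    intro i hi
    have hf : (0 : ℝ) < ((i+2).factorial : ℝ) / 2 := by positivity
    rw [Real.rpow_add hf, Real.rpow_one]
    have h1 : (((i+2).factorial : ℝ) / 2) ^ γ ≤ (t ^ γ) ^ i := by
      rw [← Real.rpow_natCast (t ^ γ) i, ← Real.rpow_mul htpos.le, mul_comm γ, Real.rpow_mul htpos.le,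
        Real.rpow_natCast]
      exact Real.rpow_le_rpow hf.le (hN i (Finset.mem_range.1 hi)) hγ
    calc _ = h ^ 2 / 2 * H * ((((i+2).factorial : ℝ) / 2) ^ γ * (h ^ i / Δ ^ i)) := by
            have : (((i+2).factorial : ℝ)) ≠ 0 := by positivity
            field_simp
            ring
      _ ≤ h ^ 2 / 2 * H * ((t ^ γ) ^ i * (h ^ i / Δ ^ i)) := by gcongr
      _ = _ := by rw [hq, div_pow, mul_pow]; ring
  refine (Finset.sum_le_sum hterm).trans ?_
  rw [← Finset.mul_sum, mul_assoc]
  have hq1 : 1 - q ≥ H / (H + B) := by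
    have : H / (H + B) = 1 - B / (H + B) := by field_simp; ring
    linarith
  have hHD : 0 < H / (H + B) := by positivity
  have hgs : (∑ i ∈ Finset.range N, q ^ i) * (1 - q) ≤ 1 := by
    rw [geom_sum_mul_neg]
    have : 0 < q ^ N := by positivity
    linarith
  have hs0 : 0 ≤ ∑ i ∈ Finset.range N, q ^ i := Finset.sum_nonneg fun i _ => by positivity
  have : H * ∑ i ∈ Finset.range N, q ^ i ≤ H + B := by
    have h1 : (∑ i ∈ Finset.range N, q ^ i) * (H / (H + B)) ≤ 1 :=
      (mul_le_mul_of_nonneg_left hq1 hs0).trans hgs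
    have h2 : (∑ i ∈ Finset.range N, q ^ i) * (H / (H + B)) =
      (H * ∑ i ∈ Finset.range N, q ^ i) / (H + B) := by ring
    rw [h2, div_le_one hD] at h1
    exact h1
  gcongr

lemma tail_expT {Ω : Type} [MeasurableSpace Ω] (μ : Measure Ω) [IsProbabilityMeasure μ]
    (X : Ω → ℝ) (hX : Measurable X)
    (hint : ∀ m : ℕ, 1 ≤ m → Integrable (fun ω => |X ω| ^ m) μ) (n : ℕ) (hn : Even n)
    (x h : ℝ) (hx : 0 < x) (hh : 0 < h) :
    expT n (h * x) * (μ {ω | x ≤ X ω}).toReal ≤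
      ∑ k ∈ Finset.range (n+1), |∫ ω, X ω ^ k ∂μ| / k.factorial * h ^ k := by
  have hi : ∀ k : ℕ, Integrable (fun ω => X ω ^ k) μ := by
    intro k
    rcases Nat.eq_zero_or_pos k with rfl | hk
    · simp
    · rw [← integrable_norm_iff (hX.pow_const k).aestronglyMeasurable]
      simpa [norm_pow] using hint k hk
  have hi2 : ∀ k ∈ Finset.range (n+1), Integrable (fun ω => (h * X ω) ^ k / (k.factorial : ℝ)) μ := by
    intro k _
    have := ((hi k).const_mul (h ^ k)).div_const (k.factorial : ℝ)
    simpa [mul_pow] using this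
  have hie : Integrable (fun ω => expT n (h * X ω)) μ := by
    unfold expT
    exact integrable_finsetSum _ hi2
  have h1 := mul_meas_ge_le_integral_of_nonneg (μ := μ) (f := fun ω => expT n (h * X ω))
    (Filter.Eventually.of_forall fun ω => expT_nonneg n hn _) hie (expT n (h * x))
  have h2 : (μ {ω | x ≤ X ω}).toReal ≤ μ.real {ω | expT n (h * x) ≤ expT n (h * X ω)} := by
    apply ENNReal.toReal_mono (measure_ne_top _ _)
    apply measure_mono
    intro ω hω
    exact expT_mono n (by positivity) (mul_le_mul_of_nonneg_left hω hh.le)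
  have h3 : ∫ ω, expT n (h * X ω) ∂μ = ∑ k ∈ Finset.range (n+1), (∫ ω, X ω ^ k ∂μ) / k.factorial * h ^ k := by
    unfold expT
    rw [integral_finsetSum _ hi2]
    refine Finset.sum_congr rfl fun k _ => ?_
    rw [integral_div]
    simp only [mul_pow]
    rw [integral_const_mul]; ring
  have h4 : ∑ k ∈ Finset.range (n+1), (∫ ω, X ω ^ k ∂μ) / k.factorial * h ^ k ≤
      ∑ k ∈ Finset.range (n+1), |∫ ω, X ω ^ k ∂μ| / k.factorial * h ^ k := by
    gcongr
    exact le_abs_self _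
  calc _ ≤ expT n (h * x) * μ.real {ω | expT n (h * x) ≤ expT n (h * X ω)} :=
        mul_le_mul_of_nonneg_left h2 (expT_nonneg n hn _)
    _ ≤ _ := h1
    _ ≤ _ := h3 ▸ h4

lemma sum_moments_le (a : ℕ → ℝ) (h0 : a 0 = 1) (h : ℝ) (hh : 0 < h) (n : ℕ) :
    ∑ k ∈ Finset.range (n+1), |a k| / k.factorial * h ^ k ≤
      Real.exp (∑ i ∈ Finset.range n, |cumA a (i+1)| / (i+1).factorial * h ^ (i+1)) := by
  apply exp_bound_of_rec n (fun k => |a k| / k.factorial * h ^ k)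
    (fun k => |cumA a k| / k.factorial * h ^ k)
  · intro k; positivity
  · intro k; positivity
  · simp [h0]
  · intro k _
    have hr := congrArg abs (moment_rec a h0 k)
    have e1 : |(k + 1 : ℝ) * (a (k + 1) / (k+1).factorial)| = (k + 1 : ℝ) * (|a (k + 1)| / (k+1).factorial) := by
      rw [abs_mul, abs_div, abs_of_pos (by positivity : (0 : ℝ) < k + 1), Nat.abs_cast]
    rw [e1] at hr
    have h2 := mul_le_mul_of_nonneg_right (hr.le.trans (Finset.abs_sum_le_sum_abs _ _))
      (pow_nonneg hh.le (k+1))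
    calc _ = (k + 1 : ℝ) * (|a (k + 1)| / (k+1).factorial) * h ^ (k+1) := by ring
      _ ≤ _ := h2
      _ = _ := by
        rw [Finset.sum_mul]
        refine Finset.sum_congr rfl fun i hi => ?_
        have hp : h ^ (k+1) = h ^ (i+1) * h ^ (k - i) := by
          rw [← pow_add]; congr 1; have := Finset.mem_range.1 hi; omega
        rw [abs_mul, abs_mul, abs_div, abs_div, abs_of_pos (by positivity : (0 : ℝ) < i + 1),
          Nat.abs_cast, Nat.abs_cast, hp]
        ring

/-- extension of the Bentkus–Rudzkis inequality under multiple
Statulevičius conditions. There is a finite universal constant `C` such that: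
if `X` is a centered real random variable with all moments finite, and the
cumulants of `X` satisfy `|κ_m(X)| ≤ ∑_j (m!/2)^{1+γ_j} H_j / Δ_j^{m−2}` for all
`m ≥ 2`, then for every `x > 0`,
`P(X ≥ x) ≤ C · max_j exp(− x²/(2J · (H_j + x^{2−α_j}/Δ_j^{α_j})))` where
`α_j = 1/(1+γ_j)`. -/
theorem statement1 :
    ∃ C : ℝ, 0 < C ∧
      ∀ {Ω : Type} [MeasurableSpace Ω] (μ : Measure Ω), IsProbabilityMeasure μ →
      ∀ (X : Ω → ℝ), Measurable X →
      (∀ m : ℕ, 1 ≤ m → Integrable (fun ω => |X ω| ^ m) μ) →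
      (∫ ω, X ω ∂μ) = 0 →
      ∀ (J : ℕ) (hJ : 1 ≤ J) (γ H Δ : Fin J → ℝ),
      (∀ j, 0 ≤ γ j) → (∀ j, 0 < H j) → (∀ j, 0 < Δ j) →
      (∀ m : ℕ, 2 ≤ m →
        |cumulantM μ X m| ≤
          ∑ j, ((Nat.factorial m : ℝ) / 2) ^ (1 + γ j) * H j / Δ j ^ (m - 2)) →
      ∀ x : ℝ, 0 < x →
        (μ {ω | x ≤ X ω}).toReal ≤
          C * (Finset.univ.sup' ⟨⟨0, hJ⟩, Finset.mem_univ _⟩ fun j =>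
            Real.exp (- (1 / (2 * (J : ℝ))) * x ^ 2 /
              (H j + x ^ (2 - 1 / (1 + γ j)) / Δ j ^ (1 / (1 + γ j))))) := by
  refine ⟨3 * Real.exp 4, by positivity, ?_⟩
  intro Ω _ μ hμ X hX hint hmean J hJ γ H Δ hγ hH hΔ hcum x hx
  set D : Fin J → ℝ := fun j => H j + x ^ (2 - 1 / (1 + γ j)) / Δ j ^ (1 / (1 + γ j)) with hDdef
  have hDpos : ∀ j, 0 < D j := fun j => by
    have := hH j; have := hΔ j
    simp only [hDdef]; positivity
  obtain ⟨j0, -, hj0⟩ := Finset.exists_max_image (Finset.univ : Finset (Fin J)) D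
    ⟨⟨0, hJ⟩, Finset.mem_univ _⟩
  have hJpos : (0 : ℝ) < J := by exact_mod_cast hJ
  have hsup : Real.exp (- (1 / (2 * (J : ℝ))) * x ^ 2 / D j0) ≤
      (Finset.univ.sup' ⟨⟨0, hJ⟩, Finset.mem_univ _⟩ fun j =>
            Real.exp (- (1 / (2 * (J : ℝ))) * x ^ 2 /
              (H j + x ^ (2 - 1 / (1 + γ j)) / Δ j ^ (1 / (1 + γ j))))) :=
    Finset.le_sup' (fun j => Real.exp (- (1 / (2 * (J : ℝ))) * x ^ 2 / D j)) (Finset.mem_univ j0)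
  refine le_trans ?_ (mul_le_mul_of_nonneg_left hsup (by positivity))
  have hD0 := hDpos j0
  set h := x / (J * D j0) with hh
  have hhpos : 0 < h := by positivity
  have hexp : - (1 / (2 * (J : ℝ))) * x ^ 2 / D j0 = -(h * x) / 2 := by
    rw [hh]; field_simp
  rw [hexp]
  set t := h * x with ht
  have htpos : 0 < t := by positivity
  rcases lt_or_ge t 8 with ht8 | ht8
  · have h1 : (μ {ω | x ≤ X ω}).toReal ≤ 1 := by
      have := measureReal_le_one (μ := μ) (s := {ω | x ≤ X ω})
      exact this
    have h2 : 1 ≤ Real.exp 4 * Real.exp (-t / 2) := by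
      rw [← Real.exp_add]; exact Real.one_le_exp (by linarith)
    linarith
  · set n := 2 * ⌊t - 3 / 2⌋₊ with hn
    have hfl1 : (⌊t - 3 / 2⌋₊ : ℝ) ≤ t - 3 / 2 := Nat.floor_le (by linarith)
    have hfl2 : t - 3 / 2 < ⌊t - 3 / 2⌋₊ + 1 := Nat.lt_floor_add_one _
    have hn1 : (n : ℝ) ≤ 2 * t - 3 := by rw [hn]; push_cast; linarith
    have hn2 : 2 * t - 5 ≤ (n : ℝ) := by rw [hn]; push_cast; linarith
    have hne : Even n := ⟨_, by rw [hn]; ring⟩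
    have hfac : ∀ i, i < n - 1 → ((i+2).factorial : ℝ) / 2 ≤ t ^ i := by
      intro i hi
      refine (fact_half_le i).trans ?_
      have : ((i + 2 : ℕ) : ℝ) ≤ n := by exact_mod_cast (by omega : i + 2 ≤ n)
      push_cast at this
      gcongr
      linarith
    set a : ℕ → ℝ := fun k => ∫ ω, X ω ^ k ∂μ with ha
    have a0 : a 0 = 1 := by simp [ha]
    have a1 : a 1 = 0 := by simpa [ha] using hmean
    have hc1 : cumA a 1 = 0 := by
      have := moment_rec a a0 0
      simpa [a0, a1] using this.symm
    have hcumA : ∀ m, cumulantM μ X m = cumA a m := fun m => rfl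
    have hn0 : n - 1 + 1 = n := by
      have : (0 : ℝ) < n := by linarith
      have : 0 < n := by exact_mod_cast this
      omega
    have hsumle : ∑ i ∈ Finset.range n, |cumA a (i+1)| / (i+1).factorial * h ^ (i+1) ≤ t / 2 := by
      rw [← hn0, Finset.sum_range_succ']
      simp only [zero_add, hc1, abs_zero, zero_div, zero_mul, add_zero]
      calc _ ≤ ∑ i ∈ Finset.range (n-1), ∑ j, (((i+2).factorial : ℝ) / 2) ^ (1 + γ j) * H j / Δ j ^ i *
            (h ^ (i+2) / (i+2).factorial) := by
            refine Finset.sum_le_sum fun i _ => ?_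
            have := hcum (i+2) (by omega)
            rw [hcumA, Nat.add_sub_cancel] at this
            rw [← Finset.sum_mul]
            calc _ = |cumA a (i+2)| * (h ^ (i+2) / (i+2).factorial) := by
                  rw [show i + 1 + 1 = i + 2 from rfl]; ring
              _ ≤ _ := mul_le_mul_of_nonneg_right this (by positivity)
        _ = ∑ j, ∑ i ∈ Finset.range (n-1), (((i+2).factorial : ℝ) / 2) ^ (1 + γ j) * H j / Δ j ^ i *
            (h ^ (i+2) / (i+2).factorial) := Finset.sum_comm
        _ ≤ ∑ j : Fin J, h ^ 2 / 2 * D j0 := by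
            refine Finset.sum_le_sum fun j _ => ?_
            have hDj := hDpos j
            have hJD : D j ≤ J * D j0 := by
              have h1 := hj0 j (Finset.mem_univ j)
              have h2 : (1 : ℝ) ≤ J := by exact_mod_cast hJ
              nlinarith
            refine (geo_bound (γ j) (H j) (Δ j) x h (hγ j) (hH j) (hΔ j) hx hhpos ?_ (n-1) hfac).trans ?_
            · change x / (J * D j0) ≤ x / D j
              gcongr
            · exact mul_le_mul_of_nonneg_left (hj0 j (Finset.mem_univ j)) (by positivity)
        _ = t / 2 := by
            rw [Finset.sum_const, Finset.card_univ, Fintype.card_fin, nsmul_eq_mul, ht, hh]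
            field_simp
    have h1 := tail_expT μ X hX hint n hne x h hx hhpos
    have h2 := sum_moments_le a a0 h hhpos n
    have h3 : Real.exp (∑ i ∈ Finset.range n, |cumA a (i+1)| / (i+1).factorial * h ^ (i+1)) ≤
      Real.exp (t / 2) := Real.exp_le_exp.2 hsumle
    have h4 : expT n t * (μ {ω | x ≤ X ω}).toReal ≤ Real.exp (t / 2) := h1.trans (h2.trans h3)
    have h5 := expT_lower n t htpos.le
    have h6 : t / (n + 1) ≤ 2 / 3 := by
      rw [div_le_div_iff₀ (by positivity) (by norm_num)]; linarith
    have h7 : Real.exp t / 3 ≤ expT n t := by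
      have := Real.exp_pos t
      nlinarith
    have h8 : Real.exp t / 3 * (μ {ω | x ≤ X ω}).toReal ≤ Real.exp (t / 2) :=
      (mul_le_mul_of_nonneg_right h7 ENNReal.toReal_nonneg).trans h4
    have h9 : (μ {ω | x ≤ X ω}).toReal ≤ 3 * Real.exp (-t / 2) := by
      have e : Real.exp (t / 2) = Real.exp t * Real.exp (-t / 2) := by
        rw [← Real.exp_add]; congr 1; ring
      rw [e] at h8
      have := Real.exp_pos t
      nlinarith
    have h10 : (1 : ℝ) ≤ Real.exp 4 := Real.one_le_exp (by norm_num)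
    have h11 := Real.exp_pos (-t / 2)
    nlinarith
end

section
/- There exists a constant c_ψ ∈ (0,∞) such that for every dimension d ≥ 1, every integer i_max ≥ 2 and I := { i ∈ ℕ^d : max_{1≤l≤d} i_l < i_max } (so |I| = i_max^d), the following three bounds hold: (i) (1/|I|) ∑_{i∈I} ‖ψ_i‖_3² ≤ c_ψ^d |I|^{−1/6}; (ii) for every real p ≥ 4, (1/|I|) ∑_{i∈I} ‖ψ_i‖_p² ≤ c_ψ^d (log i_max)^{2d/p} |I|^{−1/(3p) − 1/6}; (iii) for every real p ≥ 4, (1/|I|) ∑_{i∈I} ‖ψ_i‖_p ≤ c_ψ^d (log i_max)^{d/p} |I|^{−1/(6p) − 1/12}. -/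
open Finset MeasureTheory

/-- The `n`-th Hermite function factor
`H_n(y) = (−1)^n (2^n n! √π)^{−1/2} e^{y²} (d^n/dy^n) e^{−y²}`. -/
noncomputable def hermiteH (n : ℕ) (y : ℝ) : ℝ :=
  (-1 : ℝ) ^ n * (Real.sqrt (2 ^ n * n.factorial * Real.sqrt Real.pi))⁻¹ *
    Real.exp (y ^ 2) * iteratedDeriv n (fun t => Real.exp (-t ^ 2)) y

/-- The multivariate Hermite function `ψ_i(x) = e^{−|x|²/2} ∏_l H_{i_l}(x_l)`. -/
noncomputable def hermitePsi {d : ℕ} (i : Fin d → ℕ) (x : EuclideanSpace ℝ (Fin d)) : ℝ :=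
  Real.exp (-‖x‖ ^ 2 / 2) * ∏ l, hermiteH (i l) (x l)

/-- The `L^p(ℝ^d)` norm `(∫ |f|^p)^{1/p}` of a real function on `ℝ^d`. -/
noncomputable def lpNorm (d : ℕ) (f : EuclideanSpace ℝ (Fin d) → ℝ) (p : ℝ) : ℝ :=
  (∫ x, |f x| ^ p) ^ (1 / p)


lemma ode_tail {h k : ℝ → ℝ} {L : ℝ}
    (hh : ∀ x, HasDerivAt h (k x) x) (hk : ∀ x, HasDerivAt k ((x^2 - L) * h x) x)
    (hlim : Filter.Tendsto h Filter.atTop (nhds 0)) {a x0 : ℝ} (ha : 0 ≤ a) (hx0 : 0 ≤ x0)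
    (hq : a^2 ≤ x0^2 - L) (x : ℝ) (hx : x0 ≤ x) : h x * k x + a * h x ^ 2 ≤ 0 := by
  by_contra hc
  push Not at hc
  set c := h x * k x + a * h x ^ 2 with hcdef
  have hv : ∀ y, HasDerivAt (fun y => h y * k y + a * h y ^ 2)
      (k y * k y + h y * ((y^2 - L) * h y) + a * (2 * h y * k y)) y := by
    intro y
    have := ((hh y).mul (hk y)).add (((hh y).pow 2).const_mul a)
    refine HasDerivAt.congr_deriv this ?_
    push_cast; ring
  have hmono : MonotoneOn (fun y => h y * k y + a * h y ^ 2) (Set.Ici x0) := by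
    apply monotoneOn_of_deriv_nonneg (convex_Ici x0)
    · exact fun y _ => (hv y).continuousAt.continuousWithinAt
    · exact fun y _ => (hv y).differentiableAt.differentiableWithinAt
    · intro y hy
      rw [interior_Ici] at hy
      have hy' : x0 < y := hy
      rw [(hv y).deriv]
      have h1 : a^2 ≤ y^2 - L := by nlinarith
      have h2 : 0 ≤ (y^2 - L - a^2) * h y ^2 := mul_nonneg (by linarith) (sq_nonneg _)
      nlinarith [sq_nonneg (k y + a * h y)]
  have hge : ∀ y, x ≤ y → c ≤ h y * k y + a * h y ^ 2 := fun y hy =>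
    hmono (Set.mem_Ici.2 hx) (Set.mem_Ici.2 (hx.trans hy)) hy
  have hu : Filter.Tendsto (fun y => a * h y ^ 2) Filter.atTop (nhds 0) := by
    simpa using (hlim.pow 2).const_mul a
  have hu1 : Filter.Tendsto (fun y => h y ^ 2) Filter.atTop (nhds 0) := by
    simpa using (hlim.pow 2)
  obtain ⟨Y, hY⟩ := Filter.eventually_atTop.1 (hu.eventually (gt_mem_nhds (half_pos hc)))
  obtain ⟨Z, hZ⟩ := Filter.eventually_atTop.1 (hu1.eventually (gt_mem_nhds one_pos))
  set X := max x (max Y Z) with hX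
  have hd : ∀ y, HasDerivAt (fun y => h y ^ 2 - c * y) (2 * h y * k y - c) y := by
    intro y
    have := ((hh y).pow 2).sub ((hasDerivAt_id y).const_mul c)
    refine HasDerivAt.congr_deriv this ?_
    push_cast; ring
  have hmono2 : MonotoneOn (fun y => h y ^ 2 - c * y) (Set.Ici X) := by
    apply monotoneOn_of_deriv_nonneg (convex_Ici X)
    · exact fun y _ => (hd y).continuousAt.continuousWithinAt
    · exact fun y _ => (hd y).differentiableAt.differentiableWithinAt
    · intro y hy
      rw [interior_Ici] at hy
      have hy' : X < y := hy
      rw [(hd y).deriv]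
      have h1 := hge y ((le_max_left _ _).trans hy'.le)
      have h2 := hY y (((le_max_left _ _).trans (le_max_right _ _)).trans hy'.le)
      linarith
  have hXY : X ≤ X + 1 / c := by
    have : 0 < 1 / c := by positivity
    linarith
  have h3 := hmono2 (Set.mem_Ici.2 le_rfl) (Set.mem_Ici.2 hXY) hXY
  have h4 := hZ (X + 1/c) (((le_max_right _ _).trans (le_max_right _ _)).trans hXY)
  simp only at h3
  have h5 : c * (X + 1/c) = c * X + 1 := by field_simp
  nlinarith [sq_nonneg (h X)]

lemma ode_tail_decay {h k : ℝ → ℝ} {L : ℝ}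
    (hh : ∀ x, HasDerivAt h (k x) x) (hk : ∀ x, HasDerivAt k ((x^2 - L) * h x) x)
    (hlim : Filter.Tendsto h Filter.atTop (nhds 0)) {a x0 : ℝ} (ha : 0 ≤ a) (hx0 : 0 ≤ x0)
    (hq : a^2 ≤ x0^2 - L) (x : ℝ) (hx : x0 ≤ x) :
    h x ^ 2 ≤ h x0 ^ 2 * Real.exp (- (2 * a * (x - x0))) := by
  have hd : ∀ y, HasDerivAt (fun y => h y ^ 2 * Real.exp (2 * a * (y - x0)))
      (2 * (h y * k y + a * h y ^ 2) * Real.exp (2 * a * (y - x0))) y := by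
    intro y
    have := ((hh y).pow 2).mul ((((hasDerivAt_id y).sub_const x0).const_mul (2*a)).exp)
    refine HasDerivAt.congr_deriv this ?_
    · simp; ring
  have hmono : AntitoneOn (fun y => h y ^ 2 * Real.exp (2 * a * (y - x0))) (Set.Ici x0) := by
    apply antitoneOn_of_deriv_nonpos (convex_Ici x0)
    · exact fun y _ => (hd y).continuousAt.continuousWithinAt
    · exact fun y _ => (hd y).differentiableAt.differentiableWithinAt
    · intro y hy
      rw [interior_Ici] at hy
      rw [(hd y).deriv]
      have := ode_tail hh hk hlim ha hx0 hq y (le_of_lt hy)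
      exact mul_nonpos_of_nonpos_of_nonneg (by linarith) (Real.exp_pos _).le
  have := hmono (Set.mem_Ici.2 le_rfl) (Set.mem_Ici.2 hx) hx
  simp only [sub_self, mul_zero, Real.exp_zero, mul_one] at this
  rw [Real.exp_neg, ← div_eq_mul_inv, le_div_iff₀ (Real.exp_pos _)]
  exact this

lemma ode_bulk {h k : ℝ → ℝ} {s A : ℝ} (hs : 1 ≤ s)
    (hh : ∀ x, HasDerivAt h (k x) x) (hk : ∀ x, HasDerivAt k ((x^2 - s^6) * h x) x)
    (hA : s^3 * h 0 ^ 2 + k 0 ^ 2 / s^3 ≤ A) (x : ℝ) (hx0 : 0 ≤ x) (hx : x ≤ s^3 - 1/s) :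
    Real.sqrt (s^6 - x^2) * h x ^ 2 + k x ^ 2 / Real.sqrt (s^6 - x^2) ≤ 6 * A := by
  have hs0 : 0 < s := by linarith
  set w : ℝ → ℝ := fun x => Real.sqrt (s^6 - x^2) with hw
  have hphi : ∀ y, 0 ≤ y → y ≤ s^3 - 1/s → s^2 ≤ s^6 - y^2 := by
    intro y h0 h1
    have h2 : 1 / s * s^3 ≤ (s^3 - y) * (s^3 + y) := by
      apply mul_le_mul (by linarith) (by linarith) (by positivity)
      have : 0 < 1/s := by positivity
      linarith
    have h3 : 1 / s * s^3 = s^2 := by field_simp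
    nlinarith
  have hws : ∀ y, 0 ≤ y → y ≤ s^3 - 1/s → s ≤ w y := by
    intro y h0 h1
    exact Real.le_sqrt_of_sq_le (hphi y h0 h1)
  have hw2 : ∀ y, 0 ≤ y → y ≤ s^3 - 1/s → w y ^ 2 = s^6 - y^2 := by
    intro y h0 h1
    exact Real.sq_sqrt (by have := hphi y h0 h1; nlinarith)
  have hwd : ∀ y, 0 ≤ y → y ≤ s^3 - 1/s → HasDerivAt w (-y / w y) y := by
    intro y h0 h1
    have hp := hphi y h0 h1
    have := (((hasDerivAt_id y).pow 2).const_sub (s^6)).sqrt (by simp; nlinarith)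
    refine HasDerivAt.congr_deriv this ?_
    · have : w y ≠ 0 := by have := hws y h0 h1; linarith
      simp only [hw] at this ⊢
      simp
      field_simp
  -- energy
  set E : ℝ → ℝ := fun y => w y * h y ^ 2 + k y ^ 2 / w y - y / w y ^ 3 * (h y * k y) with hE
  have hEF : ∀ y, 0 ≤ y → y ≤ s^3 - 1/s →
      y / w y ^ 3 ≤ 1 ∧ |h y * k y| ≤ (w y * h y ^ 2 + k y ^ 2 / w y) / 2 := by
    intro y h0 h1
    have hp := hws y h0 h1
    have hwp : 0 < w y := by linarith
    constructor
    · rw [div_le_one (by positivity)]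
      have : s^3 ≤ w y ^ 3 := by gcongr
      have : 0 < 1/s := by positivity
      linarith
    · have e : w y * h y ^ 2 + k y ^ 2 / w y = ((w y * h y)^2 + k y ^ 2) / w y := by
        field_simp
      rw [e, abs_le]
      constructor
      · rw [← sub_nonneg]
        have : h y * k y - -(((w y * h y)^2 + k y ^ 2) / w y / 2) = (w y * h y + k y)^2 / (2 * w y) := by
          field_simp; ring
        rw [this]; positivity
      · rw [← sub_nonneg]
        have : (((w y * h y)^2 + k y ^ 2) / w y / 2) - h y * k y = (w y * h y - k y)^2 / (2 * w y) := by
          field_simp; ring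
        rw [this]; positivity
  have hEge : ∀ y, 0 ≤ y → y ≤ s^3 - 1/s → (w y * h y ^ 2 + k y ^ 2 / w y) / 2 ≤ E y := by
    intro y h0 h1
    obtain ⟨h2, h3⟩ := hEF y h0 h1
    have hp := hws y h0 h1
    have hwp : 0 < w y := by linarith
    have h4 : y / w y ^ 3 * (h y * k y) ≤ 1 * |h y * k y| := by
      calc _ ≤ y / w y ^ 3 * |h y * k y| := by gcongr; exact le_abs_self _
        _ ≤ _ := by gcongr
    simp only [hE]; linarith
  have hgd : ∀ y, 0 ≤ y → y ≤ s^3 - 1/s →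
      HasDerivAt (fun y => y / w y ^ 3) (1 / w y ^ 3 + 3 * y^2 / w y ^ 5) y := by
    intro y h0 h1
    have hp := hws y h0 h1
    have hwp : w y ≠ 0 := by linarith
    have := (hasDerivAt_id y).div ((hwd y h0 h1).pow 3) (pow_ne_zero 3 hwp)
    refine HasDerivAt.congr_deriv this ?_
    · simp; field_simp; ring
  have hEd : ∀ y, 0 ≤ y → y ≤ s^3 - 1/s →
      HasDerivAt E (-(1 / w y ^ 3 + 3 * y^2 / w y ^ 5) * (h y * k y)) y := by
    intro y h0 h1
    have hp := hws y h0 h1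
    have hwp : w y ≠ 0 := by linarith
    have := (((hwd y h0 h1).mul ((hh y).pow 2)).add (((hk y).pow 2).div (hwd y h0 h1) hwp)).sub
      ((hgd y h0 h1).mul ((hh y).mul (hk y)))
    refine HasDerivAt.congr_deriv this ?_
    have e : y^2 - s^6 = - w y ^ 2 := by rw [hw2 y h0 h1]; ring
    rw [e]
    simp; field_simp; ring
  set Q : ℝ → ℝ := fun y => E y * Real.exp (-(y / w y ^ 3)) with hQ
  have hQd : ∀ y, 0 ≤ y → y ≤ s^3 - 1/s →
      HasDerivAt Q (-(1 / w y ^ 3 + 3 * y^2 / w y ^ 5) * (h y * k y + E y) * Real.exp (-(y / w y ^ 3))) y := by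
    intro y h0 h1
    have := (hEd y h0 h1).mul (hgd y h0 h1).neg.exp
    refine HasDerivAt.congr_deriv this ?_
    simp; ring
  have hanti : AntitoneOn Q (Set.Icc 0 (s^3 - 1/s)) := by
    apply antitoneOn_of_deriv_nonpos (convex_Icc _ _)
    · exact fun y hy => (hQd y hy.1 hy.2).continuousAt.continuousWithinAt
    · intro y hy
      have hy := interior_subset hy
      exact (hQd y hy.1 hy.2).differentiableAt.differentiableWithinAt
    · intro y hy
      have hy := interior_subset hy
      rw [(hQd y hy.1 hy.2).deriv]
      have hp := hws y hy.1 hy.2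
      have hwp : 0 < w y := by linarith
      have h1 := hEge y hy.1 hy.2
      have h2 := (abs_le.1 (hEF y hy.1 hy.2).2).1
      have h3 : 0 ≤ (1 / w y ^ 3 + 3 * y^2 / w y ^ 5) := by positivity
      have h4 : 0 ≤ h y * k y + E y := by linarith
      have := mul_nonneg (mul_nonneg h3 h4) (Real.exp_pos (-(y / w y ^ 3))).le
      linarith
  have hfin := hanti (Set.mem_Icc.2 ⟨le_rfl, hx0.trans hx⟩) (Set.mem_Icc.2 ⟨hx0, hx⟩) hx0
  have hw0 : w 0 = s^3 := by
    simp only [hw]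
    rw [show s^6 - 0^2 = (s^3)^2 by ring]
    exact Real.sqrt_sq (by positivity)
  have hQ0 : Q 0 ≤ A := by
    simp only [hQ, hE, hw0]; simpa using hA
  have h1 := hEge x hx0 hx
  have h2 := (hEF x hx0 hx).1
  have h3 : Real.exp (x / w x ^ 3) ≤ 3 := by
    calc _ ≤ Real.exp 1 := Real.exp_le_exp.2 h2
      _ ≤ 3 := by have := Real.exp_one_lt_d9; linarith
  have h4 : E x * Real.exp (-(x / w x ^ 3)) ≤ A := hfin.trans hQ0
  rw [Real.exp_neg, ← div_eq_mul_inv, div_le_iff₀ (Real.exp_pos _)] at h4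
  have hA0 : 0 ≤ A := le_trans (by positivity) hA
  have h5 : A * Real.exp (x / w x ^ 3) ≤ A * 3 := by gcongr
  change w x * h x ^ 2 + k x ^ 2 / w x ≤ 6 * A
  linarith

lemma ode_sup {h k : ℝ → ℝ} {s A : ℝ} (hs : 1 ≤ s)
    (hh : ∀ x, HasDerivAt h (k x) x) (hk : ∀ x, HasDerivAt k ((x^2 - s^6) * h x) x)
    (hlim : Filter.Tendsto h Filter.atTop (nhds 0))
    (hA : s^3 * h 0 ^ 2 + k 0 ^ 2 / s^3 ≤ A) (x : ℝ) (hx0 : 0 ≤ x) :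
    h x ^ 2 ≤ 36 * A / s := by
  have hs0 : 0 < s := by linarith
  have hA0 : 0 ≤ A := le_trans (by positivity) hA
  have his : 0 < 1 / s := by positivity
  have hss : 1 / s ≤ s^3 := by
    rw [div_le_iff₀ hs0]
    have : (1:ℝ) ≤ s^4 := one_le_pow₀ hs
    linarith [this, show s^3 * s = s^4 by ring]
  have hbulk := ode_bulk hs hh hk hA
  -- sqrt lower bound
  have hsw : ∀ y, 0 ≤ y → y ≤ s^3 - 1/s → s ≤ Real.sqrt (s^6 - y^2) := by
    intro y h0 h1
    apply Real.le_sqrt_of_sq_le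
    have h2 : 1 / s * s^3 ≤ (s^3 - y) * (s^3 + y) := by
      apply mul_le_mul (by linarith) (by linarith) (by positivity)
      linarith
    have h3 : 1 / s * s^3 = s^2 := by field_simp
    nlinarith
  have hI : ∀ y, 0 ≤ y → y ≤ s^3 - 1/s → h y ^ 2 ≤ 6 * A / s := by
    intro y h0 h1
    have h2 := hbulk y h0 h1
    have h3 := hsw y h0 h1
    rw [le_div_iff₀ hs0]
    have h4 : 0 ≤ k y ^ 2 / Real.sqrt (s^6 - y^2) := by positivity
    have h5 : s * h y ^ 2 ≤ Real.sqrt (s^6 - y^2) * h y ^ 2 := by gcongr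
    linarith
  set x1 := s^3 - 1/s with hx1
  have hx10 : 0 ≤ x1 := by linarith
  have hEn : ∀ y, HasDerivAt (fun y => k y ^ 2 + (s^6 - y^2) * h y ^ 2) (-(2 * y) * h y ^ 2) y := by
    intro y
    have := ((hk y).pow 2).add ((((hasDerivAt_id y).pow 2).const_sub (s^6)).mul ((hh y).pow 2))
    refine HasDerivAt.congr_deriv this ?_
    simp; ring
  have hEanti : AntitoneOn (fun y => k y ^ 2 + (s^6 - y^2) * h y ^ 2) (Set.Ici 0) := by
    apply antitoneOn_of_deriv_nonpos (convex_Ici 0)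
    · exact fun y _ => (hEn y).continuousAt.continuousWithinAt
    · exact fun y _ => (hEn y).differentiableAt.differentiableWithinAt
    · intro y hy
      rw [interior_Ici] at hy
      have hy : 0 < y := hy
      rw [(hEn y).deriv]
      have : 0 ≤ 2 * y * h y ^ 2 := by positivity
      linarith
  have hE1 : k x1 ^ 2 + (s^6 - x1^2) * h x1 ^ 2 ≤ 12 * A * s := by
    have h2 := hbulk x1 hx10 le_rfl
    have h3 := hsw x1 hx10 le_rfl
    set w := Real.sqrt (s^6 - x1^2) with hw
    have hw0 : 0 < w := by linarith
    have hpos : 0 < s^6 - x1^2 := Real.sqrt_pos.1 hw0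
    have hw2 : w^2 = s^6 - x1^2 := Real.sq_sqrt hpos.le
    have hw3 : w ≤ 2 * s := by
      apply Real.sqrt_le_iff.2
      refine ⟨by positivity, ?_⟩
      have : s^6 - x1^2 = 2 * s^2 - (1/s)^2 := by rw [hx1]; field_simp; ring
      nlinarith [sq_nonneg (1/s), sq_nonneg s]
    rw [← hw2]
    calc k x1 ^ 2 + w^2 * h x1 ^ 2 = w * (w * h x1 ^ 2 + k x1 ^ 2 / w) := by field_simp; ring
      _ ≤ (2 * s) * (6 * A) := by gcongr
      _ = _ := by ring
  have hkb : ∀ y ∈ Set.Icc x1 (s^3), ‖k y‖ ≤ Real.sqrt (12 * A * s) := by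
    intro y hy
    rw [Real.norm_eq_abs]
    apply Real.abs_le_sqrt
    have h2 := hEanti (Set.mem_Ici.2 hx10) (Set.mem_Ici.2 (hx10.trans hy.1)) hy.1
    simp only at h2
    have h3 : 0 ≤ (s^6 - y^2) * h y ^ 2 := by
      apply mul_nonneg _ (sq_nonneg _)
      have : 0 ≤ y := hx10.trans hy.1
      have := hy.2
      nlinarith
    linarith
  have hII : ∀ y, x1 ≤ y → y ≤ s^3 → h y ^ 2 ≤ 36 * A / s := by
    intro y h0 h1
    have h2 := (convex_Icc x1 (s^3)).norm_image_sub_le_of_norm_hasDerivWithin_le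
      (f := h) (f' := k) (fun z _ => (hh z).hasDerivWithinAt) hkb
      (Set.mem_Icc.2 ⟨le_rfl, by linarith⟩) (Set.mem_Icc.2 ⟨h0, h1⟩)
    have h3 : ‖y - x1‖ ≤ 1 / s := by
      rw [Real.norm_eq_abs, abs_of_nonneg (by linarith)]; linarith
    have h4 : (h y - h x1)^2 ≤ 12 * A / s := by
      have h5 : ‖h y - h x1‖ ≤ Real.sqrt (12 * A * s) * (1 / s) := h2.trans (by gcongr)
      calc (h y - h x1)^2 = ‖h y - h x1‖^2 := by rw [Real.norm_eq_abs, sq_abs]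
        _ ≤ (Real.sqrt (12 * A * s) * (1 / s))^2 := by gcongr
        _ = 12 * A / s := by
          rw [mul_pow, Real.sq_sqrt (by positivity)]; field_simp
    have h6 := hI x1 hx10 le_rfl
    have h7 : h y ^ 2 ≤ 2 * (h y - h x1)^2 + 2 * h x1^2 := by nlinarith [sq_nonneg (h y - 2 * h x1)]
    calc h y ^ 2 ≤ 2 * (12 * A / s) + 2 * (6 * A / s) := by linarith
      _ = 36 * A / s := by ring
  rcases le_total x x1 with h1 | h1
  · refine (hI x hx0 h1).trans ?_
    gcongr; norm_num
  rcases le_total x (s^3) with h2 | h2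
  · exact hII x h1 h2
  · have := ode_tail_decay hh hk hlim (a := 0) (x0 := s^3) le_rfl (by positivity) (by ring_nf; rfl) x h2
    simp only [mul_zero, zero_mul, neg_zero, Real.exp_zero, mul_one] at this
    have h3 := hII (s^3) (by linarith) le_rfl
    exact this.trans h3

noncomputable def hG (n : ℕ) (y : ℝ) : ℝ := iteratedDeriv n (fun t => Real.exp (-t ^ 2)) y

noncomputable def hC (n : ℕ) : ℝ :=
  (-1 : ℝ) ^ n * (Real.sqrt (2 ^ n * n.factorial * Real.sqrt Real.pi))⁻¹

noncomputable def hF (n : ℕ) (y : ℝ) : ℝ := hC n * (Real.exp (y^2/2) * hG n y)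

noncomputable def hK (n : ℕ) (y : ℝ) : ℝ := hC n * (Real.exp (y^2/2) * (y * hG n y + hG (n+1) y))

lemma hF_eq (n : ℕ) (y : ℝ) : Real.exp (-y^2/2) * hermiteH n y = hF n y := by
  unfold hermiteH hF hC hG
  have : Real.exp (y^2) = Real.exp (y^2/2) * Real.exp (y^2/2) := by rw [← Real.exp_add]; ring_nf
  rw [this]
  have h2 : Real.exp (-y^2/2) * Real.exp (y^2/2) = 1 := by rw [← Real.exp_add]; ring_nf; simp
  linear_combination ((-1) ^ n * (Real.sqrt (2 ^ n * n.factorial * Real.sqrt Real.pi))⁻¹ *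
    Real.exp (y ^ 2/2) * iteratedDeriv n (fun t => Real.exp (-t ^ 2)) y) * h2

lemma hG_deriv (n : ℕ) (y : ℝ) : HasDerivAt (hG n) (hG (n+1) y) y := by
  have hc : ContDiff ℝ (n+1 : ℕ) (fun t : ℝ => Real.exp (-t ^ 2)) := by fun_prop
  have hd : Differentiable ℝ (iteratedDeriv n (fun t : ℝ => Real.exp (-t ^ 2))) :=
    hc.differentiable_iteratedDeriv n (by exact_mod_cast Nat.lt_succ_self n)
  have := (hd y).hasDerivAt
  rw [← iteratedDeriv_succ] at this
  exact this

lemma hG_rec (n : ℕ) : ∀ y, hG (n+2) y = -2 * y * hG (n+1) y - 2 * (n+1) * hG n y := by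
  have h1 : ∀ y, hG 1 y = -2 * y * hG 0 y := by
    intro y
    have h := hG_deriv 0 y
    have h' : HasDerivAt (hG 0) (Real.exp (-y^2) * (-(2 * y))) y := by
      have e : hG 0 = fun t => Real.exp (-t^2) := by funext t; simp [hG]
      rw [e]
      have := ((hasDerivAt_id y).pow 2).neg.exp
      refine HasDerivAt.congr_deriv this ?_
      simp
    rw [h.unique h']
    simp [hG]; ring
  induction n with
  | zero =>
    intro y
    have h := hG_deriv 1 y
    have e : hG 1 = fun y => (-2 * y) * hG 0 y := funext h1
    have h2 := ((hasDerivAt_id y).const_mul (-2)).mul (hG_deriv 0 y)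
    have h3 : HasDerivAt (hG 1) ((-2 * 1) * hG 0 y + (-2 * id y) * hG (0+1) y) y := by
      exact h2.congr_of_eventuallyEq (Filter.Eventually.of_forall (fun z => congrFun e z))
    rw [h.unique h3]
    simp; ring
  | succ n ih =>
    intro y
    have h := hG_deriv (n+2) y
    have e : hG (n+2) = fun y => (-2 * y) * hG (n+1) y - 2 * (n+1) * hG n y := funext ih
    have h2 := (((hasDerivAt_id y).const_mul (-2)).mul (hG_deriv (n+1) y)).sub
      ((hG_deriv n y).const_mul (2 * ((n:ℝ)+1)))
    have h3 : HasDerivAt (hG (n+2)) ((-2 * 1) * hG (n+1) y + (-2 * id y) * hG (n+1+1) y - 2 * ((n:ℝ)+1) * hG (n+1) y) y := by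
      exact h2.congr_of_eventuallyEq (Filter.Eventually.of_forall (fun z => congrFun e z))
    rw [h.unique h3]
    simp; ring

lemma hF_deriv (n : ℕ) (y : ℝ) : HasDerivAt (hF n) (hK n y) y := by
  have := (((((hasDerivAt_id y).pow 2).div_const 2).exp).mul (hG_deriv n y)).const_mul (hC n)
  refine HasDerivAt.congr_deriv this ?_
  simp [hK]; ring_nf; tauto

lemma hK_deriv (n : ℕ) (y : ℝ) : HasDerivAt (hK n) ((y^2 - (2*n+1)) * hF n y) y := by
  have := (((((hasDerivAt_id y).pow 2).div_const 2).exp).mul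
    (((hasDerivAt_id y).mul (hG_deriv n y)).add (hG_deriv (n+1) y))).const_mul (hC n)
  refine HasDerivAt.congr_deriv this ?_
  have h := hG_rec n y
  simp only [show n + 1 + 1 = n + 2 from rfl, h]
  simp [hF]; ring

lemma hG_poly (n : ℕ) : ∃ P : Polynomial ℝ, ∀ y, hG n y = P.eval y * Real.exp (-y^2) := by
  induction n with
  | zero => exact ⟨1, fun y => by simp [hG]⟩
  | succ n ih =>
    obtain ⟨P, hP⟩ := ih
    refine ⟨P.derivative - 2 * Polynomial.X * P, fun y => ?_⟩
    have h := hG_deriv n y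
    have h2 := (P.hasDerivAt y).mul (((hasDerivAt_id y).pow 2).neg.exp)
    have h3 := h2.congr_of_eventuallyEq (f₁ := hG n) (Filter.Eventually.of_forall (fun z => hP z))
    rw [h.unique h3]
    simp; ring

lemma hF_lim (n : ℕ) : Filter.Tendsto (hF n) Filter.atTop (nhds 0) := by
  obtain ⟨P, hP⟩ := hG_poly n
  have h1 := (P.tendsto_div_exp_atTop).abs.const_mul (|hC n| * Real.exp (1/2))
  simp only [abs_zero, mul_zero] at h1
  refine squeeze_zero_norm (fun y => ?_) h1
  have h2 : Real.exp (y^2/2) * Real.exp (-y^2) ≤ Real.exp (1/2) * (Real.exp y)⁻¹ := by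
    rw [← Real.exp_neg, ← Real.exp_add, ← Real.exp_add, Real.exp_le_exp]
    nlinarith [sq_nonneg (y-1)]
  unfold hF
  rw [hP, Real.norm_eq_abs]
  have e : |hC n * (Real.exp (y^2/2) * (P.eval y * Real.exp (-y^2)))|
      = |hC n| * |P.eval y| * (Real.exp (y^2/2) * Real.exp (-y^2)) := by
    rw [abs_mul, abs_mul, abs_mul, abs_of_pos (Real.exp_pos _), abs_of_pos (Real.exp_pos _)]; ring
  rw [e, abs_div, abs_of_pos (Real.exp_pos y)]
  calc _ ≤ |hC n| * |P.eval y| * (Real.exp (1/2) * (Real.exp y)⁻¹) := by gcongr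
    _ = _ := by rw [div_eq_mul_inv]; ring

lemma hG_neg (n : ℕ) (y : ℝ) : hG n (-y) = (-1)^n * hG n y := by
  have := iteratedDeriv_comp_neg n (fun t : ℝ => Real.exp (-t^2)) y
  simp only [neg_sq, smul_eq_mul] at this
  unfold hG
  rw [this, ← mul_assoc, ← mul_pow]; simp

lemma hF_abs (n : ℕ) (y : ℝ) : |hF n (|y|)| = |hF n y| := by
  rcases abs_choice y with h | h <;> rw [h]
  simp [hF, hG_neg, abs_mul]

lemma hC_sq (n : ℕ) : hC n ^ 2 = (2 ^ n * n.factorial * Real.sqrt Real.pi)⁻¹ := by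
  unfold hC
  rw [mul_pow, inv_pow, Real.sq_sqrt (by positivity), ← pow_mul, mul_comm n 2, pow_mul]; simp

lemma hF_zero_rec (n : ℕ) : hF (n+2) 0 ^ 2 = (n+1)/(n+2) * hF n 0 ^ 2 := by
  unfold hF
  rw [mul_pow, mul_pow (hC n), hC_sq, hC_sq, hG_rec]
  have : 0 < Real.sqrt Real.pi := Real.sqrt_pos.2 Real.pi_pos
  have h2 : (0:ℝ) < n.factorial := by exact_mod_cast n.factorial_pos
  simp [Nat.factorial_succ]
  field_simp
  ring

lemma hF_zero_bound (n : ℕ) : hF n 0 ^ 2 ≤ 1 / Real.sqrt (n+1) := by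
  induction n using Nat.twoStepInduction with
  | zero =>
    unfold hF
    rw [mul_pow, hC_sq]
    simp [hG]
    apply inv_le_one_of_one_le₀
    rw [Real.one_le_sqrt]
    linarith [Real.pi_gt_three]
  | one =>
    have : hG 1 0 = 0 := by
      have := hG_neg 1 0
      simp at this; linarith
    simp [hF, this]
  | more n ih _ =>
    rw [hF_zero_rec]
    have h1 : (0:ℝ) < n + 1 := by positivity
    calc ((n:ℝ)+1)/(n+2) * hF n 0 ^ 2 ≤ ((n:ℝ)+1)/(n+2) * (1 / Real.sqrt (n+1)) := by gcongr
      _ = Real.sqrt (n+1) / (n+2) := by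
        have h3 := Real.sq_sqrt h1.le
        have : 0 < Real.sqrt ((n:ℝ)+1) := Real.sqrt_pos.2 h1
        field_simp
        linarith
      _ ≤ _ := by
        have h4 : (0:ℝ) < n + 3 := by positivity
        push_cast
        rw [show (n:ℝ) + 2 + 1 = n + 3 by ring, div_le_div_iff₀ (by positivity) (Real.sqrt_pos.2 h4),
          ← Real.sqrt_mul h1.le, one_mul]
        apply Real.sqrt_le_iff.2
        constructor
        · positivity
        · nlinarith

lemma hK_zero (n : ℕ) : hK n 0 ^ 2 = 2 * (n+1) * hF (n+1) 0 ^ 2 := by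
  unfold hF hK
  rw [mul_pow, mul_pow (hC (n+1)), hC_sq, hC_sq]
  have : 0 < Real.sqrt Real.pi := Real.sqrt_pos.2 Real.pi_pos
  have h2 : (0:ℝ) < n.factorial := by exact_mod_cast n.factorial_pos
  simp [Nat.factorial_succ]
  field_simp
  ring

lemma h_init (n : ℕ) {s : ℝ} (hs : 1 ≤ s) (hsn : s^6 = 2*n+1) :
    s^3 * hF n 0 ^ 2 + hK n 0 ^ 2 / s^3 ≤ 4 := by
  have hs0 : 0 < s := by linarith
  have hs3 : s^3 = Real.sqrt (2*n+1) := by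
    rw [← hsn, show s^6 = (s^3)^2 by ring, Real.sqrt_sq (by positivity)]
  have h1 : s^3 * hF n 0 ^ 2 ≤ 2 := by
    have : 0 < Real.sqrt ((n:ℝ)+1) := Real.sqrt_pos.2 (by positivity)
    calc s^3 * hF n 0 ^ 2 ≤ s^3 * (1 / Real.sqrt (n+1)) := by gcongr; exact hF_zero_bound n
      _ ≤ 2 := by
        rw [mul_one_div, div_le_iff₀ this, hs3]
        apply Real.sqrt_le_iff.2
        refine ⟨by positivity, ?_⟩
        rw [mul_pow, Real.sq_sqrt (by positivity)]; nlinarith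
  have h2 : hK n 0 ^ 2 / s^3 ≤ 2 := by
    rw [hK_zero, div_le_iff₀ (by positivity)]
    have h3 := hF_zero_bound (n+1)
    push_cast at h3
    have : 0 < Real.sqrt ((n:ℝ)+1+1) := Real.sqrt_pos.2 (by positivity)
    calc 2 * ((n:ℝ)+1) * hF (n+1) 0 ^ 2 ≤ 2 * ((n:ℝ)+1) * (1 / Real.sqrt (n+1+1)) := by gcongr
      _ ≤ 2 * s^3 := by
        rw [mul_one_div, div_le_iff₀ this, hs3, mul_assoc, ← Real.sqrt_mul (by positivity)]
        gcongr
        apply Real.le_sqrt_of_sq_le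
        nlinarith [show (0:ℝ) ≤ n by positivity]
  linarith

lemma abs_rpow_sq (x p : ℝ) : |x| ^ p = (x^2) ^ (p/2) := by
  rw [← sq_abs, ← Real.rpow_natCast, ← Real.rpow_mul (abs_nonneg _)]
  congr 1; push_cast; ring

lemma int_bound {h k : ℝ → ℝ} {s : ℝ} (hs : 1 ≤ s)
    (hh : ∀ x, HasDerivAt h (k x) x) (hk : ∀ x, HasDerivAt k ((x^2 - s^6) * h x) x)
    (hlim : Filter.Tendsto h Filter.atTop (nhds 0))
    (hA : s^3 * h 0 ^ 2 + k 0 ^ 2 / s^3 ≤ 4) {p : ℝ} (hp : 1 ≤ p) :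
    IntegrableOn (fun x => |h x| ^ p) (Set.Ioi 0) ∧
    ∫ x in Set.Ioi 0, |h x| ^ p ≤
      (24 : ℝ) ^ (p/2) * (s^3) ^ (-(p/4)) * (∫ x in (1/s)..(s^3), x ^ (-(p/4)))
        + 3 * (144 / s) ^ (p/2) / s := by
  have hs0 : 0 < s := by linarith
  have his : 0 < 1 / s := by positivity
  have hss : 1 / s ≤ s^3 := by
    rw [div_le_iff₀ hs0]
    have : (1:ℝ) ≤ s^4 := one_le_pow₀ hs
    linarith [this, show s^3 * s = s^4 by ring]
  set a := s^3 - 1/s with ha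
  set b := s^3 + 1/s with hb
  have ha0 : 0 ≤ a := by linarith
  have hab : a ≤ b := by linarith
  have hb0 : 0 ≤ b := by linarith
  have hhc : Continuous h := continuous_iff_continuousAt.2 fun x => (hh x).continuousAt
  have hcont : Continuous (fun x => |h x| ^ p) :=
    (continuous_abs.comp hhc).rpow_const (fun x => Or.inr (by linarith))
  have hsup : ∀ x, 0 ≤ x → |h x| ^ p ≤ (144 / s) ^ (p/2) := by
    intro x hx
    rw [abs_rpow_sq]
    have := ode_sup hs hh hk hlim hA x hx
    norm_num at this
    exact Real.rpow_le_rpow (sq_nonneg _) this (by linarith)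
  have htail : ∀ x, b ≤ x → |h x| ^ p ≤ (144 / s) ^ (p/2) * Real.exp (s * b) * Real.exp (-s * x) := by
    intro x hx
    have h1 := ode_tail_decay hh hk hlim (a := s) (x0 := b) hs0.le hb0 (by
      have : b^2 - s^6 = 2 * s^2 + (1/s)^2 := by rw [hb]; field_simp; ring
      nlinarith [sq_nonneg s, sq_nonneg (1/s)]) x hx
    have h2 := ode_sup hs hh hk hlim hA b hb0
    norm_num at h2
    have h3 : h x ^ 2 ≤ 144 / s * Real.exp (- (2 * s * (x - b))) := h1.trans (by gcongr)
    rw [abs_rpow_sq]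
    calc (h x ^ 2) ^ (p/2) ≤ (144 / s * Real.exp (- (2 * s * (x - b)))) ^ (p/2) :=
          Real.rpow_le_rpow (sq_nonneg _) h3 (by linarith)
      _ = (144 / s) ^ (p/2) * Real.exp (- (p * (s * (x - b)))) := by
          rw [Real.mul_rpow (by positivity) (Real.exp_pos _).le, ← Real.exp_mul]
          congr 2; ring
      _ ≤ (144 / s) ^ (p/2) * Real.exp (- (1 * (s * (x - b)))) := by
          have : 0 ≤ x - b := by linarith
          gcongr
      _ = _ := by
          rw [mul_assoc, ← Real.exp_add]; congr 2; ring
  have hmajI : IntegrableOn (fun x => (144 / s) ^ (p/2) * Real.exp (s * b) * Real.exp (-s * x)) (Set.Ioi b) :=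
    (integrableOn_exp_mul_Ioi (by linarith) b).const_mul _
  have hIb : IntegrableOn (fun x => |h x| ^ p) (Set.Ioi b) := by
    refine Integrable.mono' hmajI hcont.aestronglyMeasurable.restrict ?_
    refine (ae_restrict_iff' measurableSet_Ioi).2 (Filter.Eventually.of_forall fun x hx => ?_)
    rw [Real.norm_of_nonneg (by positivity)]
    exact htail x (le_of_lt hx)
  have hI0 : IntegrableOn (fun x => |h x| ^ p) (Set.Ioi 0) := by
    rw [← Set.Ioc_union_Ioi_eq_Ioi hb0]
    exact (hcont.integrableOn_Ioc).union hIb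
  refine ⟨hI0, ?_⟩
  have hi : ∀ u v, IntervalIntegrable (fun x => |h x| ^ p) volume u v :=
    fun u v => hcont.intervalIntegrable u v
  have e1 : ∫ x in Set.Ioi 0, |h x| ^ p = (∫ x in (0:ℝ)..a, |h x| ^ p) + (∫ x in a..b, |h x| ^ p)
      + ∫ x in Set.Ioi b, |h x| ^ p := by
    rw [intervalIntegral.integral_add_adjacent_intervals (hi _ _) (hi _ _)]
    exact (intervalIntegral.integral_interval_add_Ioi hI0 hIb).symm
  have b3 : ∫ x in Set.Ioi b, |h x| ^ p ≤ (144 / s) ^ (p/2) / s := by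
    calc _ ≤ ∫ x in Set.Ioi b, (144 / s) ^ (p/2) * Real.exp (s * b) * Real.exp (-s * x) :=
          setIntegral_mono_on hIb hmajI measurableSet_Ioi (fun x hx => htail x (le_of_lt hx))
      _ = _ := by
          rw [integral_const_mul, integral_exp_mul_Ioi (by linarith)]
          have : Real.exp (s * b) * Real.exp (-(s * b)) = 1 := by rw [← Real.exp_add]; simp
          rw [neg_mul]
          field_simp
          linear_combination this
  have b2 : (∫ x in a..b, |h x| ^ p) ≤ 2 * (144 / s) ^ (p/2) / s := by
    calc _ ≤ ∫ x in a..b, (144 / s) ^ (p/2) := by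
          apply intervalIntegral.integral_mono_on hab (hi _ _) (by simp)
          intro x hx
          exact hsup x (ha0.trans hx.1)
      _ = _ := by
          rw [intervalIntegral.integral_const, smul_eq_mul, ha, hb]; ring
  have b1 : (∫ x in (0:ℝ)..a, |h x| ^ p) ≤
      (24 : ℝ) ^ (p/2) * (s^3) ^ (-(p/4)) * (∫ x in (1/s)..(s^3), x ^ (-(p/4))) := by
    have e2 : (∫ x in (1/s)..(s^3), x ^ (-(p/4))) = ∫ x in (0:ℝ)..a, (s^3 - x) ^ (-(p/4)) := by
      rw [intervalIntegral.integral_comp_sub_left (fun x => x ^ (-(p/4))) (s^3)]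
      simp [ha]
    rw [e2, ← intervalIntegral.integral_const_mul]
    apply intervalIntegral.integral_mono_on ha0 (hi _ _)
    · apply ContinuousOn.intervalIntegrable
      apply ContinuousOn.mul continuousOn_const
      apply ContinuousOn.rpow_const (by fun_prop)
      intro x hx
      rw [Set.uIcc_of_le ha0] at hx
      left
      have := hx.2
      linarith
    · intro x hx
      have hx1 : 0 < s^3 - x := by have := hx.2; linarith
      have hx0 := hx.1
      have h1 := ode_bulk hs hh hk hA x hx.1 hx.2
      norm_num at h1
      have hu : s^3 * (s^3 - x) ≤ s^6 - x^2 := by nlinarith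
      have hu0 : 0 < s^3 * (s^3 - x) := by positivity
      have h2 : Real.sqrt (s^3 * (s^3 - x)) * h x ^ 2 ≤ 24 := by
        have h3 : Real.sqrt (s^3 * (s^3 - x)) * h x ^ 2 ≤ Real.sqrt (s^6 - x^2) * h x ^ 2 := by gcongr
        have h4 : 0 ≤ k x ^ 2 / Real.sqrt (s^6 - x^2) := by positivity
        linarith
      have h5 : h x ^ 2 ≤ 24 * (s^3 * (s^3 - x)) ^ (-(1/2:ℝ)) := by
        rw [Real.rpow_neg hu0.le, ← Real.sqrt_eq_rpow, ← div_eq_mul_inv, le_div_iff₀ (Real.sqrt_pos.2 hu0)]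
        linarith
      rw [abs_rpow_sq]
      calc (h x ^ 2) ^ (p/2) ≤ (24 * (s^3 * (s^3 - x)) ^ (-(1/2:ℝ))) ^ (p/2) :=
            Real.rpow_le_rpow (sq_nonneg _) h5 (by linarith)
        _ = _ := by
            rw [Real.mul_rpow (by norm_num) (by positivity), ← Real.rpow_mul hu0.le,
              show -(1/2:ℝ) * (p/2) = -(p/4) by ring, Real.mul_rpow (by positivity) hx1.le, mul_assoc]
  rw [e1]
  have : 3 * (144 / s) ^ (p/2) / s = 2 * (144 / s) ^ (p/2) / s + (144 / s) ^ (p/2) / s := by ring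
  linarith

noncomputable def hN (n : ℕ) (p : ℝ) : ℝ := (∫ x, |hF n x| ^ p) ^ (1 / p)

lemma hF_even_int (n : ℕ) (p : ℝ) : ∫ x, |hF n x| ^ p = 2 * ∫ x in Set.Ioi 0, |hF n x| ^ p := by
  have := integral_comp_abs (f := fun x => |hF n x| ^ p)
  simp only [hF_abs] at this
  exact this

lemma exists_s (n : ℕ) : ∃ s : ℝ, 1 ≤ s ∧ s^6 = 2*n+1 ∧ s = (2*n+1 : ℝ) ^ (1/6 : ℝ) ∧
    ((n:ℝ)+1) ^ (1/6 : ℝ) ≤ s := by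
  have h1 : (1:ℝ) ≤ 2*n+1 := by
    have : (0:ℝ) ≤ n := by positivity
    linarith
  refine ⟨(2*n+1 : ℝ) ^ (1/6 : ℝ), Real.one_le_rpow h1 (by norm_num), ?_, rfl, ?_⟩
  · rw [← Real.rpow_natCast, ← Real.rpow_mul (by positivity)]; norm_num
  · apply Real.rpow_le_rpow (by positivity) _ (by norm_num)
    have : (0:ℝ) ≤ n := by positivity
    linarith

lemma s_rpow_le (n : ℕ) {s t : ℝ} (hs : ((n:ℝ)+1) ^ (1/6 : ℝ) ≤ s) (ht : 0 ≤ t) :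
    s ^ (-t) ≤ ((n:ℝ)+1) ^ (-(t/6)) := by
  have h0 : (0:ℝ) < (n:ℝ)+1 := by positivity
  calc s ^ (-t) ≤ (((n:ℝ)+1) ^ (1/6 : ℝ)) ^ (-t) :=
        Real.rpow_le_rpow_of_nonpos (by positivity) hs (by linarith)
    _ = _ := by rw [← Real.rpow_mul h0.le]; congr 1; ring

lemma hF_int (n : ℕ) {s p : ℝ} (hs : 1 ≤ s) (hsn : s^6 = 2*n+1) (hp : 1 ≤ p) :
    IntegrableOn (fun x => |hF n x| ^ p) (Set.Ioi 0) ∧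
    ∫ x in Set.Ioi 0, |hF n x| ^ p ≤
      (24 : ℝ) ^ (p/2) * (s^3) ^ (-(p/4)) * (∫ x in (1/s)..(s^3), x ^ (-(p/4)))
        + 3 * (144 / s) ^ (p/2) / s :=
  int_bound hs (hF_deriv n) (by rw [hsn]; exact hK_deriv n) (hF_lim n) (h_init n hs hsn) hp

lemma hF_sup (n : ℕ) {s : ℝ} (hs : 1 ≤ s) (hsn : s^6 = 2*n+1) (x : ℝ) (hx : 0 ≤ x) :
    hF n x ^ 2 ≤ 144 / s := by
  have := ode_sup hs (hF_deriv n) (by rw [hsn]; exact hK_deriv n) (hF_lim n) (h_init n hs hsn) x hx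
  norm_num at this
  exact this

lemma hN_nonneg (n : ℕ) (p : ℝ) : 0 ≤ hN n p := by
  unfold hN
  apply Real.rpow_nonneg
  exact integral_nonneg fun x => by positivity

lemma hN_three (n : ℕ) : hN n 3 ≤ 23 * ((n:ℝ)+1) ^ (-(1/12) : ℝ) := by
  obtain ⟨s, hs, hsn, -, hsl⟩ := exists_s n
  have hs0 : 0 < s := by linarith
  have h := (hF_int n hs hsn (p := 3) (by norm_num)).2
  have e1 : (∫ x in (1/s)..(s^3), x ^ (-(3/4) : ℝ)) ≤ 4 * (s^3) ^ (1/4 : ℝ) := by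
    rw [integral_rpow (Or.inl (by norm_num))]
    have : 0 ≤ (1/s) ^ (-(3/4) + 1 : ℝ) := by positivity
    rw [div_le_iff₀ (by norm_num)]
    norm_num at this ⊢
    linarith
  have e2 : (24:ℝ) ^ (3/2 : ℝ) ≤ 125 := by
    calc (24:ℝ) ^ (3/2 : ℝ) ≤ 25 ^ (3/2 : ℝ) := Real.rpow_le_rpow (by norm_num) (by norm_num) (by norm_num)
      _ = ((5:ℝ)^(2:ℝ)) ^ (3/2 : ℝ) := by norm_num
      _ = 125 := by rw [← Real.rpow_mul (by norm_num)]; norm_num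
  have e3 : (144/s) ^ (3/2 : ℝ) = 1728 * s ^ (-(3/2) : ℝ) := by
    rw [Real.div_rpow (by norm_num) hs0.le, Real.rpow_neg hs0.le, div_eq_mul_inv]
    congr 1
    rw [show (144:ℝ) = 12 ^ (2:ℝ) by norm_num, ← Real.rpow_mul (by norm_num)]; norm_num
  have e4 : (s^3) ^ (-(3/4) : ℝ) * (s^3) ^ (1/4 : ℝ) = s ^ (-(3/2) : ℝ) := by
    rw [← Real.rpow_add (by positivity), ← Real.rpow_natCast, ← Real.rpow_mul hs0.le]; norm_num
  have e5 : 0 < s ^ (-(3/2) : ℝ) := by positivity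
  have h2 : ∫ x in Set.Ioi 0, |hF n x| ^ (3:ℝ) ≤ 6000 * s ^ (-(3/2) : ℝ) := by
    refine h.trans ?_
    calc (24 : ℝ) ^ (3/2 : ℝ) * (s^3) ^ (-(3/4) : ℝ) * (∫ x in (1/s)..(s^3), x ^ (-(3/4) : ℝ))
        + 3 * (144 / s) ^ (3/2 : ℝ) / s
        ≤ 125 * (s^3) ^ (-(3/4) : ℝ) * (4 * (s^3) ^ (1/4 : ℝ)) + 3 * (1728 * s ^ (-(3/2) : ℝ)) / 1 := by
          rw [e3]
          have hss : 1 / s ≤ s^3 := by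
            rw [div_le_iff₀ hs0]
            have : (1:ℝ) ≤ s^4 := one_le_pow₀ hs
            linarith [this, show s^3 * s = s^4 by ring]
          have hi0 : 0 ≤ ∫ x in (1/s)..(s^3), x ^ (-(3/4) : ℝ) := by
            apply intervalIntegral.integral_nonneg hss
            intro x hx
            exact Real.rpow_nonneg (le_trans (by positivity) hx.1) _
          gcongr
      _ = 500 * ((s^3) ^ (-(3/4) : ℝ) * (s^3) ^ (1/4 : ℝ)) + 5184 * s ^ (-(3/2) : ℝ) := by ring
      _ ≤ _ := by rw [e4]; linarith
  have h3 : ∫ x, |hF n x| ^ (3:ℝ) ≤ 23^(3:ℝ) * s ^ (-(3/2) : ℝ) := by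
    rw [hF_even_int]; norm_num at h2 ⊢; linarith
  unfold hN
  calc _ ≤ ((23:ℝ)^(3:ℝ) * s ^ (-(3/2) : ℝ)) ^ (1/3 : ℝ) :=
        Real.rpow_le_rpow (integral_nonneg fun x => by positivity) h3 (by norm_num)
    _ = 23 * s ^ (-(1/2) : ℝ) := by
        rw [Real.mul_rpow (by positivity) e5.le, ← Real.rpow_mul (by norm_num), ← Real.rpow_mul hs0.le]
        norm_num
    _ ≤ 23 * ((n:ℝ)+1) ^ (-(1/2/6) : ℝ) := by
        gcongr
        exact s_rpow_le n hsl (by norm_num)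
    _ = _ := by norm_num

lemma hN_big (n N : ℕ) (hN2 : 2 ≤ N) (hn : n < N) {p : ℝ} (hp : 4 ≤ p) :
    hN n p ≤ 168 * Real.log N ^ (1/p) * ((n:ℝ)+1) ^ (-(1/(6*p) + 1/12)) := by
  obtain ⟨s, hs, hsn, hse, hsl⟩ := exists_s n
  have hs0 : 0 < s := by linarith
  have hls : 0 ≤ Real.log s := Real.log_nonneg hs
  have hp0 : 0 < p := by linarith
  obtain ⟨hI, h⟩ := hF_int n hs hsn (p := 4) (by norm_num)
  have e1 : (∫ x in (1/s)..(s^3), x ^ (-(4/4) : ℝ)) = 4 * Real.log s := by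
    have : ∀ x : ℝ, x ^ (-(4/4) : ℝ) = x⁻¹ := by
      intro x; norm_num [Real.rpow_neg_one]
    simp only [this]
    rw [integral_inv_of_pos (by positivity) (by positivity)]
    rw [show s^3/(1/s) = s^4 by field_simp, Real.log_pow]; norm_num
  have h2 : ∫ x in Set.Ioi 0, |hF n x| ^ (4:ℝ) ≤ 62208 * (1 + Real.log s) * s ^ (-(3:ℝ)) := by
    refine h.trans ?_
    have e2 : s ^ (-(3:ℝ)) = (s^3)⁻¹ := by
      rw [Real.rpow_neg hs0.le]; norm_cast
    have e3 : (s^3) ^ (-(4/4) : ℝ) = (s^3)⁻¹ := by norm_num [Real.rpow_neg_one]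
    have e4 : (24:ℝ) ^ (4/2 : ℝ) = 576 := by norm_num
    have e5 : (144/s) ^ (4/2 : ℝ) = (144/s)^2 := by norm_num
    rw [e1, e2, e3, e4, e5]
    have : 576 * (s^3)⁻¹ * (4 * Real.log s) + 3 * (144/s)^2/s = (2304 * Real.log s + 62208) * (s^3)⁻¹ := by
      field_simp; ring
    rw [this]
    gcongr
    linarith
  have h3 : ∫ x in Set.Ioi 0, |hF n x| ^ p ≤
      (144/s) ^ ((p-4)/2) * ∫ x in Set.Ioi 0, |hF n x| ^ (4:ℝ) := by
    rw [← integral_const_mul]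
    refine integral_mono_of_nonneg (Filter.Eventually.of_forall fun x => by positivity)
      (hI.const_mul _) ?_
    refine (ae_restrict_iff' measurableSet_Ioi).2 (Filter.Eventually.of_forall fun x hx => ?_)
    have hx : 0 < x := hx
    have e : |hF n x| ^ p = |hF n x| ^ (p-4) * |hF n x| ^ (4:ℝ) := by
      rw [← Real.rpow_add_of_nonneg (abs_nonneg _) (by linarith) (by norm_num)]; congr 1; ring
    simp only
    rw [e, abs_rpow_sq _ (p-4)]
    gcongr
    exact hF_sup n hs hsn x hx.le
  have e6 : (144/s) ^ ((p-4)/2) * s ^ (-(3:ℝ)) * 20736 = 12 ^ p * s ^ (-(1 + p/2)) := by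
    rw [Real.div_rpow (by norm_num) hs0.le, div_eq_mul_inv, ← Real.rpow_neg hs0.le]
    have : (144:ℝ) ^ ((p-4)/2) * 20736 = 12 ^ p := by
      rw [show (144:ℝ) = 12 ^ (2:ℝ) by norm_num, ← Real.rpow_mul (by norm_num),
        show (20736:ℝ) = 12 ^ (4:ℝ) by norm_num, ← Real.rpow_add (by norm_num)]
      congr 1; ring
    rw [← this]
    have e7 : s ^ (-((p-4)/2)) * s ^ (-(3:ℝ)) = s ^ (-(1 + p/2)) := by
      rw [← Real.rpow_add hs0]; congr 1; ring
    rw [← e7]; ring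
  have hNpos : (2:ℝ) ≤ N := by exact_mod_cast hN2
  have hlog2 : (1/2 : ℝ) ≤ Real.log N := by
    have := Real.log_two_gt_d9
    have := Real.log_le_log (by norm_num) hNpos
    linarith
  have hlog : 6 * (1 + Real.log s) ≤ 14 * Real.log N := by
    have h5 : Real.log s = 1/6 * Real.log (2*n+1) := by
      rw [hse, Real.log_rpow (by positivity)]
    have h6 : Real.log (2*n+1) ≤ Real.log ((N:ℝ)^2) := by
      apply Real.log_le_log (by positivity)
      have : (n:ℝ) + 1 ≤ N := by exact_mod_cast hn
      nlinarith
    rw [Real.log_pow] at h6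
    push_cast at h6
    linarith
  have h4 : ∫ x, |hF n x| ^ p ≤ 12 ^ p * (14 * Real.log N) * s ^ (-(1 + p/2)) := by
    rw [hF_even_int]
    calc 2 * ∫ x in Set.Ioi 0, |hF n x| ^ p
        ≤ 2 * ((144/s) ^ ((p-4)/2) * (62208 * (1 + Real.log s) * s ^ (-(3:ℝ)))) := by
          gcongr
          exact h3.trans (by gcongr)
      _ = 6 * (1 + Real.log s) * ((144/s) ^ ((p-4)/2) * s ^ (-(3:ℝ)) * 20736) := by ring
      _ = 6 * (1 + Real.log s) * (12 ^ p * s ^ (-(1 + p/2))) := by rw [e6]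
      _ ≤ 14 * Real.log N * (12 ^ p * s ^ (-(1 + p/2))) := by gcongr
      _ = _ := by ring
  have hl0 : 0 ≤ Real.log N := by linarith
  unfold hN
  calc _ ≤ (12 ^ p * (14 * Real.log N) * s ^ (-(1 + p/2))) ^ (1/p) :=
        Real.rpow_le_rpow (integral_nonneg fun x => by positivity) h4 (by positivity)
    _ = 12 * (14 ^ (1/p) * Real.log N ^ (1/p)) * s ^ (-(1/p + 1/2)) := by
        rw [Real.mul_rpow (by positivity) (by positivity), Real.mul_rpow (by positivity) (by positivity),
          Real.mul_rpow (by positivity) (by positivity), ← Real.rpow_mul (by norm_num),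
          ← Real.rpow_mul hs0.le]
        have a1 : p * (1/p) = 1 := by field_simp
        have a2 : -(1 + p/2) * (1/p) = -(1/p + 1/2) := by field_simp
        rw [a1, a2, Real.rpow_one]
    _ ≤ 12 * (14 * Real.log N ^ (1/p)) * ((n:ℝ)+1) ^ (-((1/p + 1/2)/6)) := by
        gcongr
        · calc (14:ℝ) ^ (1/p) ≤ 14 ^ (1:ℝ) := by
                apply Real.rpow_le_rpow_of_exponent_le (by norm_num)
                rw [div_le_one hp0]; linarith
            _ = 14 := by norm_num
        · exact s_rpow_le n hsl (by positivity)
    _ = _ := by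
        have : -((1/p + 1/2)/6) = -(1/(6*p) + 1/12) := by field_simp; ring
        rw [this]; ring

lemma sum_rpow_le (N : ℕ) {t : ℝ} (ht : t ≤ 1/2) :
    ∑ n : Fin N, ((n:ℝ)+1) ^ (-t) ≤ 2 * (N * (N:ℝ) ^ (-t)) := by
  have h1 : ∀ M : ℕ, ∑ n ∈ range M, (Real.sqrt ((n:ℝ)+1))⁻¹ ≤ 2 * Real.sqrt M := by
    intro M
    induction M with
    | zero => simp
    | succ M ih =>
      rw [sum_range_succ]
      push_cast
      have h2 : 0 < Real.sqrt ((M:ℝ)+1) := Real.sqrt_pos.2 (by positivity)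
      have h3 : Real.sqrt ((M:ℝ)+1) ^ 2 = M + 1 := Real.sq_sqrt (by positivity)
      have h4 : Real.sqrt (M:ℝ) ^ 2 = M := Real.sq_sqrt (by positivity)
      have h5 : (Real.sqrt ((M:ℝ)+1))⁻¹ ≤ 2 * Real.sqrt ((M:ℝ)+1) - 2 * Real.sqrt M := by
        rw [inv_le_iff_one_le_mul₀ h2]
        nlinarith [sq_nonneg (Real.sqrt ((M:ℝ)+1) - Real.sqrt M)]
      linarith
  rw [Fin.sum_univ_eq_sum_range (fun n : ℕ => ((n:ℝ)+1) ^ (-t)) N]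
  rcases Nat.eq_zero_or_pos N with h0 | h0
  · subst h0; simp
  have hN0 : (0:ℝ) < N := by exact_mod_cast h0
  calc ∑ n ∈ range N, ((n:ℝ)+1) ^ (-t)
      ≤ ∑ n ∈ range N, (Real.sqrt ((n:ℝ)+1))⁻¹ * (N:ℝ) ^ (1/2 - t) := by
        apply sum_le_sum
        intro n hn
        have hn' : (n:ℝ) + 1 ≤ N := by exact_mod_cast mem_range.1 hn
        have hp : (0:ℝ) < (n:ℝ)+1 := by positivity
        rw [Real.sqrt_eq_rpow, ← Real.rpow_neg hp.le,
          show -t = -(1/2) + (1/2 - t) by ring, Real.rpow_add hp]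
        have : ((n:ℝ)+1) ^ (1/2 - t) ≤ (N:ℝ) ^ (1/2 - t) :=
          Real.rpow_le_rpow hp.le hn' (by linarith)
        have e : (1/2 - t) = (1/2 - t) := rfl
        gcongr
    _ = (∑ n ∈ range N, (Real.sqrt ((n:ℝ)+1))⁻¹) * (N:ℝ) ^ (1/2 - t) := by rw [sum_mul]
    _ ≤ 2 * Real.sqrt N * (N:ℝ) ^ (1/2 - t) := by gcongr; exact h1 N
    _ = _ := by
        rw [Real.sqrt_eq_rpow, mul_assoc, ← Real.rpow_add hN0]
        congr 1
        rw [show (1/2:ℝ) + (1/2 - t) = 1 + -t by ring, Real.rpow_add hN0, Real.rpow_one]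

lemma lpNorm_eq (d : ℕ) (i : Fin d → ℕ) (p : ℝ) :
    lpNorm d (hermitePsi i) p = ∏ l, hN (i l) p := by
  unfold _root_.lpNorm hN
  rw [Real.finsetProd_rpow _ _ (fun l _ => integral_nonneg fun x => by positivity)]
  congr 1
  rw [← integral_fintype_prod_volume_eq_prod (fun (l : Fin d) (x : ℝ) => |hF (i l) x| ^ p)]
  rw [← (PiLp.volume_preserving_toLp (Fin d)).integral_comp
    (MeasurableEquiv.toLp 2 (Fin d → ℝ)).measurableEmbedding]
  congr 1
  funext x
  rw [Real.finsetProd_rpow _ _ (fun l _ => abs_nonneg _), ← Finset.abs_prod]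
  congr 2
  unfold hermitePsi
  simp only [← hF_eq]
  rw [prod_mul_distrib, ← Real.exp_sum, EuclideanSpace.norm_sq_eq]
  congr 2
  simp [neg_div, Finset.sum_div]

lemma avg_bound (d N : ℕ) (hN : 2 ≤ N) (f : ℕ → ℝ) (hf : ∀ n, 0 ≤ f n) {K Λ t : ℝ}
    (hK : 0 ≤ K) (hΛ : 0 ≤ Λ)
    (ht : t ≤ 1/2) (hb : ∀ n, n < N → f n ≤ K * Λ * ((n:ℝ)+1) ^ (-t)) :
    (1 / ((N:ℝ)^d)) * ∑ i : Fin d → Fin N, ∏ l, f (i l) ≤ (2*K)^d * Λ^d * ((N:ℝ)^d) ^ (-t) := by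
  have hN0 : (0:ℝ) < N := by exact_mod_cast (by omega : 0 < N)
  have e : ∑ i : Fin d → Fin N, ∏ l, f (i l) = (∑ n : Fin N, f n) ^ d := by
    have := Finset.prod_univ_sum (fun _ : Fin d => (Finset.univ : Finset (Fin N))) (fun _ n => f n)
    simp at this
    exact this.symm
  have h1 : ∑ n : Fin N, f n ≤ N * (2 * K * Λ * (N:ℝ) ^ (-t)) := by
    calc ∑ n : Fin N, f n ≤ ∑ n : Fin N, K * Λ * ((n:ℝ)+1) ^ (-t) :=
          sum_le_sum fun n _ => hb n n.2
      _ = K * Λ * ∑ n : Fin N, ((n:ℝ)+1) ^ (-t) := by rw [mul_sum]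
      _ ≤ K * Λ * (2 * (N * (N:ℝ) ^ (-t))) := by gcongr; exact sum_rpow_le N ht
      _ = _ := by ring
  rw [e]
  have h0 : 0 ≤ ∑ n : Fin N, f n := sum_nonneg fun n _ => hf n
  calc (1 / ((N:ℝ)^d)) * (∑ n : Fin N, f n) ^ d ≤ (1 / ((N:ℝ)^d)) * (N * (2 * K * Λ * (N:ℝ) ^ (-t))) ^ d := by
        gcongr
    _ = (2*K)^d * Λ^d * ((N:ℝ) ^ (-t))^d := by
        rw [mul_pow, mul_pow, mul_pow]; field_simp
    _ = _ := by
        rw [← Real.rpow_natCast ((N:ℝ) ^ (-t)), ← Real.rpow_natCast (N:ℝ), ← Real.rpow_mul hN0.le, ← Real.rpow_mul hN0.le,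
          mul_comm (-t)]

theorem statement6 :
    ∃ cψ : ℝ, 0 < cψ ∧
      ∀ (d : ℕ), 1 ≤ d → ∀ (imax : ℕ), 2 ≤ imax →
      ((1 / ((imax : ℝ) ^ d)) * ∑ i : Fin d → Fin imax,
          lpNorm d (hermitePsi (fun l => (i l : ℕ))) 3 ^ 2
        ≤ cψ ^ d * ((imax : ℝ) ^ d) ^ (-(1 / 6) : ℝ)) ∧
      (∀ p : ℝ, 4 ≤ p →
        (1 / ((imax : ℝ) ^ d)) * ∑ i : Fin d → Fin imax,
            lpNorm d (hermitePsi (fun l => (i l : ℕ))) p ^ 2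
          ≤ cψ ^ d * Real.log imax ^ (2 * (d : ℝ) / p) *
              ((imax : ℝ) ^ d) ^ (-(1 / (3 * p)) - 1 / 6)) ∧
      (∀ p : ℝ, 4 ≤ p →
        (1 / ((imax : ℝ) ^ d)) * ∑ i : Fin d → Fin imax,
            lpNorm d (hermitePsi (fun l => (i l : ℕ))) p
          ≤ cψ ^ d * Real.log imax ^ ((d : ℝ) / p) *
              ((imax : ℝ) ^ d) ^ (-(1 / (6 * p)) - 1 / 12)) := by
  refine ⟨2 * 168^2, by norm_num, fun d _ N hN2 => ?_⟩
  have hl0 : 0 ≤ Real.log N := Real.log_natCast_nonneg N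
  refine ⟨?_, fun p hp => ?_, fun p hp => ?_⟩
  · simp only [lpNorm_eq, ← prod_pow]
    refine (avg_bound d N hN2 (fun n => hN n 3 ^ 2) (fun n => sq_nonneg _) (K := 23^2) (Λ := 1)
      (t := 1/6) (by norm_num) zero_le_one (by norm_num) ?_).trans ?_
    · intro n _
      have h1 : (0:ℝ) < (n:ℝ)+1 := by positivity
      calc hN n 3 ^ 2 ≤ (23 * ((n:ℝ)+1) ^ (-(1/12) : ℝ))^2 :=
            pow_le_pow_left₀ (hN_nonneg _ _) (hN_three n) 2
        _ = _ := by
            rw [mul_pow, ← Real.rpow_natCast (((n:ℝ)+1) ^ (-(1/12) : ℝ)), ← Real.rpow_mul h1.le]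
            norm_num
    · rw [one_pow, mul_one]
      gcongr
      norm_num
  · have hp0 : 0 < p := by linarith
    simp only [lpNorm_eq, ← prod_pow]
    refine (avg_bound d N hN2 (fun n => hN n p ^ 2) (fun n => sq_nonneg _) (K := 168^2)
      (Λ := Real.log N ^ (2/p))
      (t := 1/(3*p) + 1/6) (by norm_num) (by positivity) ?_ ?_).trans ?_
    · have : 1/(3*p) ≤ 1/(3*4) := by gcongr
      linarith
    · intro n hn
      have h1 : (0:ℝ) < (n:ℝ)+1 := by positivity
      calc hN n p ^ 2 ≤ (168 * Real.log N ^ (1/p) * ((n:ℝ)+1) ^ (-(1/(6*p) + 1/12)))^2 :=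
            pow_le_pow_left₀ (hN_nonneg _ _) (hN_big n N hN2 hn hp) 2
        _ = _ := by
            rw [mul_pow, mul_pow, ← Real.rpow_natCast (((n:ℝ)+1) ^ (-(1/(6*p) + 1/12))), ← Real.rpow_mul h1.le,
              ← Real.rpow_natCast (Real.log N ^ (1/p)), ← Real.rpow_mul hl0]
            congr 2
            · congr 1; push_cast; ring
            · push_cast; field_simp; ring
    · rw [← Real.rpow_natCast (Real.log N ^ (2/p)), ← Real.rpow_mul hl0]
      apply le_of_eq
      congr 2
      · congr 1; ring
      · ring
  · have hp0 : 0 < p := by linarith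
    simp only [lpNorm_eq]
    refine (avg_bound d N hN2 (fun n => hN n p) (fun n => hN_nonneg _ _) (K := 168)
      (Λ := Real.log N ^ (1/p))
      (t := 1/(6*p) + 1/12) (by norm_num) (by positivity) ?_ ?_).trans ?_
    · have : 1/(6*p) ≤ 1/(6*4) := by gcongr
      linarith
    · intro n hn
      exact hN_big n N hN2 hn hp
    · rw [← Real.rpow_natCast (Real.log N ^ (1/p)), ← Real.rpow_mul hl0]
      rw [show 1 / p * (d:ℝ) = d / p by ring, show -(1/(6*p) + 1/12) = -(1/(6*p)) - 1/12 by ring]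
      gcongr
      norm_num
end

section
/- Let d ≥ 1 and θ ∈ (0, 2/3]. There exist constants 0 < c, C < ∞, depending only on d and θ, such that for every nonempty finite set I ⊂ ℕ^d, setting M_I := max{ i_l : i = (i_1,…,i_d) ∈ I, 1 ≤ l ≤ d }, and for every real ρ > √( 2(M_I+1) + (M_I+1)^{1/3+θ} ), with W := [−ρ,ρ]^d: sup_{i∈I} ‖ψ_i 1_{ℝ^d∖W}‖_1 + sup_{i∈I} ‖ψ_i 1_{ℝ^d∖W}‖_2² ≤ C e^{−c ρ^{3θ}}. -/
open Finset MeasureTheory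

lemma iter_re (n : ℕ) : iteratedDeriv n (fun t : ℝ => Real.exp (-t ^ 2)) =
    fun y : ℝ => (iteratedDeriv n (fun z : ℂ => Complex.exp (-z ^ 2)) (y : ℂ)).re := by
  induction n with
  | zero =>
    funext y
    simp only [iteratedDeriv_zero]
    rw [← Complex.ofReal_pow, ← Complex.ofReal_neg, Complex.exp_ofReal_re]
  | succ n ih =>
    funext y
    rw [iteratedDeriv_succ, ih]
    have hcd : ContDiff ℂ ⊤ (fun z : ℂ => Complex.exp (-z ^ 2)) := by fun_prop
    have hd : Differentiable ℂ (iteratedDeriv n (fun z : ℂ => Complex.exp (-z ^ 2))) :=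
      hcd.differentiable_iteratedDeriv n (by exact_mod_cast WithTop.coe_lt_top _)
    rw [iteratedDeriv_succ]
    exact (hd (y : ℂ)).hasDerivAt.real_of_complex.deriv

lemma phi_bound1 (n : ℕ) (y R : ℝ) (hR : 0 < R) :
    |Real.exp (-y ^ 2 / 2) * hermiteH n y| ≤
      Real.sqrt (n.factorial / 2 ^ n) / R ^ n *
        Real.exp (R ^ 2 - (max (|y| - 2 * R) 0) ^ 2 / 2) := by
  have hd : Differentiable ℂ (fun z : ℂ => Complex.exp (-z ^ 2)) := by fun_prop
  set E := Real.exp (R ^ 2 - (max (|y| - 2 * R) 0) ^ 2 / 2) with hE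
  have hC := Complex.norm_iteratedDeriv_le_of_forall_mem_sphere_norm_le (c := (y : ℂ)) (R := R)
    (C := Real.exp (-y ^ 2 / 2) * E) n hR (hd.diffContOnCl) (f := fun z : ℂ => Complex.exp (-z ^ 2)) (by
      intro z hz
      rw [Complex.norm_exp, hE, ← Real.exp_add]
      apply Real.exp_le_exp.mpr
      rw [mem_sphere_iff_norm] at hz
      obtain ⟨w, rfl⟩ : ∃ w, z = y + w := ⟨z - y, by ring⟩
      rw [add_sub_cancel_left] at hz
      have h1 : w.re ^ 2 + w.im ^ 2 = R ^ 2 := by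
        rw [← hz, ← Complex.normSq_eq_norm_sq, Complex.normSq_apply]; ring
      have h2 : (-((y : ℂ) + w) ^ 2).re = - ((y + w.re) ^ 2 - w.im ^ 2) := by
        simp [pow_two]
      rw [h2]
      have h3 : |w.re| ≤ R := hz ▸ Complex.abs_re_le_norm w
      have h4 : (max (|y| - 2 * R) 0) ^ 2 ≤ (y + 2 * w.re) ^ 2 := by
        rw [← sq_abs (y + 2 * w.re)]
        apply pow_le_pow_left₀ (le_max_right _ _)
        apply max_le _ (abs_nonneg _)
        have := abs_sub_abs_le_abs_sub y (-(2 * w.re))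
        rw [abs_neg, abs_mul, sub_neg_eq_add, abs_two] at this
        linarith
      nlinarith)
  have hre : |iteratedDeriv n (fun t : ℝ => Real.exp (-t ^ 2)) y| ≤
      n.factorial * (Real.exp (-y ^ 2 / 2) * E) / R ^ n := by
    rw [iter_re]
    exact (Complex.abs_re_le_norm _).trans hC
  unfold hermiteH
  rw [abs_mul, abs_mul, abs_mul, abs_mul, abs_pow, abs_neg, abs_one, one_pow, one_mul,
    abs_of_pos (Real.exp_pos _), abs_of_pos (Real.exp_pos _), abs_of_nonneg (by positivity)]
  have hpi : 1 ≤ Real.sqrt Real.pi := by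
    rw [Real.one_le_sqrt]; linarith [Real.pi_gt_three]
  have hs : (Real.sqrt (2 ^ n * n.factorial * Real.sqrt Real.pi))⁻¹ * n.factorial ≤
      Real.sqrt (n.factorial / 2 ^ n) := by
    have hf : (0 : ℝ) < n.factorial := by positivity
    apply Real.le_sqrt_of_sq_le
    rw [mul_pow, inv_pow, Real.sq_sqrt (by positivity), inv_mul_eq_div, div_le_div_iff₀ (by positivity) (by positivity)]
    have : (n.factorial : ℝ) ^ 2 * 2 ^ n * 1 ≤ (n.factorial : ℝ) ^ 2 * 2 ^ n * Real.sqrt Real.pi := by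
      gcongr
    nlinarith
  have he : Real.exp (-y ^ 2 / 2) * Real.exp (y ^ 2) * Real.exp (-y ^ 2 / 2) = 1 := by
    rw [← Real.exp_add, ← Real.exp_add, Real.exp_eq_one_iff]; ring
  calc _ ≤ Real.exp (-y ^ 2 / 2) * ((Real.sqrt (2 ^ n * n.factorial * Real.sqrt Real.pi))⁻¹ * Real.exp (y ^ 2) * (n.factorial * (Real.exp (-y ^ 2 / 2) * E) / R ^ n)) := by
        gcongr
    _ = (Real.exp (-y ^ 2 / 2) * Real.exp (y ^ 2) * Real.exp (-y ^ 2 / 2)) *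
      ((Real.sqrt (2 ^ n * n.factorial * Real.sqrt Real.pi))⁻¹ * n.factorial) / R ^ n * E := by ring
    _ ≤ _ := by
      rw [he, one_mul]; gcongr

lemma fact_bound (n : ℕ) (hn : 1 ≤ n) :
    (n.factorial : ℝ) ≤ Real.exp 1 * n * (n : ℝ) ^ n * Real.exp (-n) := by
  induction n, hn using Nat.le_induction with
  | base => simp [← Real.exp_add]
  | succ n hn ih =>
    have hn' : (0 : ℝ) < n := by positivity
    have key : Real.exp 1 * (n : ℝ) ^ (n + 1) ≤ ((n : ℝ) + 1) ^ (n + 1) := by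
      have h1 : (n : ℝ) ≤ (n + 1) * Real.exp (-(1 / ((n : ℝ) + 1))) := by
        have := Real.add_one_le_exp (-(1 / ((n : ℝ) + 1)))
        calc (n : ℝ) = (n + 1) * (-(1 / ((n : ℝ) + 1)) + 1) := by field_simp; ring
          _ ≤ _ := by gcongr
      have h2 := pow_le_pow_left₀ hn'.le h1 (n + 1)
      rw [mul_pow, ← Real.exp_nat_mul] at h2
      have h3 : ((n + 1 : ℕ) : ℝ) * (-(1 / ((n : ℝ) + 1))) = -1 := by push_cast; field_simp
      rw [h3] at h2
      calc _ ≤ Real.exp 1 * (((n : ℝ) + 1) ^ (n + 1) * Real.exp (-1)) := by gcongr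
        _ = ((n : ℝ) + 1) ^ (n + 1) * (Real.exp 1 * Real.exp (-1)) := by ring
        _ = _ := by rw [← Real.exp_add]; simp
    rw [Nat.factorial_succ]
    push_cast
    have e1 : Real.exp (-((n : ℝ) + 1)) * Real.exp 1 = Real.exp (-n) := by
      rw [← Real.exp_add]; ring_nf
    calc ((n : ℝ) + 1) * n.factorial ≤ (n + 1) * (Real.exp 1 * n * (n : ℝ) ^ n * Real.exp (-n)) := by gcongr
      _ = (n + 1) * Real.exp 1 * Real.exp (-((n : ℝ) + 1)) * (Real.exp 1 * (n : ℝ) ^ (n + 1)) := by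
        rw [← e1]; ring
      _ ≤ (n + 1) * Real.exp 1 * Real.exp (-((n : ℝ) + 1)) * ((n : ℝ) + 1) ^ (n + 1) := by gcongr
      _ = _ := by ring

lemma g_bound (τ : ℝ) (h : 0 ≤ τ) :
    2 * τ - 3 + 4 * Real.exp (-τ) - Real.exp (-τ) ^ 2 ≤ 2 / 3 * τ ^ 3 := by
  have hmono : MonotoneOn (fun t : ℝ => 2 / 3 * t ^ 3 - (2 * t - 3 + 4 * Real.exp (-t) - Real.exp (-t) ^ 2)) (Set.Ici 0) := by
    have hder : ∀ t : ℝ, HasDerivAt (fun t : ℝ => 2 / 3 * t ^ 3 - (2 * t - 3 + 4 * Real.exp (-t) - Real.exp (-t) ^ 2))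
        (2 * t ^ 2 - 2 * (1 - Real.exp (-t)) ^ 2) t := by
      intro t
      have he : HasDerivAt (fun t : ℝ => Real.exp (-t)) (Real.exp (-t) * (-1)) t :=
        (hasDerivAt_neg t).exp
      have := (((hasDerivAt_id t).pow 3).const_mul (2 / 3)).sub
        (((((hasDerivAt_id t).const_mul 2).sub_const 3).add (he.const_mul 4)).sub (he.pow 2))
      refine this.congr_deriv ?_
      simp; ring
    apply monotoneOn_of_deriv_nonneg (convex_Ici 0)
    · exact fun t _ => (hder t).continuousAt.continuousWithinAt
    · exact fun t _ => (hder t).differentiableAt.differentiableWithinAt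
    · intro t ht
      rw [interior_Ici] at ht
      rw [(hder t).deriv]
      have h1 := Real.add_one_le_exp (-t)
      have h2 : Real.exp (-t) ≤ 1 := Real.exp_le_one_iff.mpr (by linarith [Set.mem_Ioi.mp ht])
      nlinarith
  have := hmono Set.self_mem_Ici h h
  simp at this
  linarith

lemma phi_bound2 (n : ℕ) (hn : 1 ≤ n) (y τ : ℝ) :
    |Real.exp (-y ^ 2 / 2) * hermiteH n y| ≤ 3 * n *
        Real.exp (n * τ - n / 2 + n / 2 * Real.exp (-τ) ^ 2 - (max (|y| - Real.sqrt (2 * n) * Real.exp (-τ)) 0) ^ 2 / 2) := by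
  have hn' : (1 : ℝ) ≤ n := by exact_mod_cast hn
  set a := Real.sqrt (2 * n) with ha
  have ha2 : a ^ 2 = 2 * n := Real.sq_sqrt (by positivity)
  have ha0 : 0 < a := by positivity
  have h1 := phi_bound1 n y (a * Real.exp (-τ) / 2) (by positivity)
  have hR : (a * Real.exp (-τ) / 2) ^ 2 = n / 2 * Real.exp (-τ) ^ 2 := by
    rw [div_pow, mul_pow, ha2]; ring
  rw [hR, show 2 * (a * Real.exp (-τ) / 2) = a * Real.exp (-τ) by ring] at h1
  refine h1.trans ?_
  have h2 : Real.sqrt (n.factorial / 2 ^ n) ≤ 3 * n * Real.exp (n * τ - n / 2) * (a * Real.exp (-τ) / 2) ^ n := by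
    apply Real.sqrt_le_iff.mpr ⟨by positivity, ?_⟩
    rw [mul_pow, ← pow_mul, mul_comm n 2, pow_mul, hR, mul_pow, ← Real.exp_nat_mul, mul_pow, ← Real.exp_nat_mul, mul_pow, ← Real.exp_nat_mul]
    have e1 : Real.exp ((2 : ℕ) * (n * τ - n / 2)) * Real.exp (n * ((2 : ℕ) * -τ)) = Real.exp (-n) := by
      rw [← Real.exp_add]; congr 1; push_cast; ring
    have hf := fact_bound n hn
    have he := Real.exp_one_lt_d9
    calc (n.factorial : ℝ) / 2 ^ n ≤ Real.exp 1 * n * (n : ℝ) ^ n * Real.exp (-n) / 2 ^ n := by gcongr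
      _ ≤ (9 * n) * n * (n : ℝ) ^ n * Real.exp (-n) / 2 ^ n := by
        gcongr
        linarith
      _ = _ := by rw [← e1, div_pow]; ring
  rw [show (n : ℝ) * τ - n / 2 + n / 2 * Real.exp (-τ) ^ 2 - (max (|y| - a * Real.exp (-τ)) 0) ^ 2 / 2 = (n * τ - n / 2) + (n / 2 * Real.exp (-τ) ^ 2 - (max (|y| - a * Real.exp (-τ)) 0) ^ 2 / 2) by ring, Real.exp_add (n * τ - n / 2), ← mul_assoc]
  gcongr
  rw [div_le_iff₀ (by positivity)]
  exact h2

lemma phi_bound3 (n : ℕ) (hn : 1 ≤ n) (y τ b : ℝ) (h0 : 0 ≤ τ) (h1 : τ ≤ 1)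
    (hb : Real.sqrt (2 * n) ≤ b) (hy : b ≤ |y|) :
    |Real.exp (-y ^ 2 / 2) * hermiteH n y| ≤ 3 * n *
        Real.exp (2 * n * τ ^ 3 / 6 - (b - Real.sqrt (2 * n)) * Real.sqrt (2 * n) * τ / 2
          - (b - Real.sqrt (2 * n)) ^ 2 / 2 - (|y| - b) ^ 2 / 2) := by
  refine (phi_bound2 n hn y τ).trans ?_
  have hn' : (1 : ℝ) ≤ n := by exact_mod_cast hn
  set a := Real.sqrt (2 * n) with ha
  have ha2 : a ^ 2 = 2 * n := Real.sq_sqrt (by positivity)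
  have ha0 : 0 < a := by positivity
  have hg := g_bound τ h0
  have hq : Real.exp (-τ) ≤ 1 - τ / 2 := by
    have h3 := Real.abs_exp_sub_one_sub_id_le (x := -τ) (by rw [abs_neg, abs_of_nonneg h0]; exact h1)
    have h4 := Real.add_one_le_exp τ
    rw [Real.exp_neg, inv_le_comm₀ (Real.exp_pos _) (by linarith)]
    refine le_trans ?_ (Real.quadratic_le_exp_of_nonneg h0)
    rw [inv_le_iff_one_le_mul₀ (by linarith)]
    nlinarith [mul_nonneg h0 (sub_nonneg.2 h1), mul_nonneg (mul_nonneg h0 h0) (sub_nonneg.2 h1)]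
  set q := Real.exp (-τ) with hqd
  have hq0 : 0 < q := Real.exp_pos _
  refine mul_le_mul_of_nonneg_left (Real.exp_le_exp.mpr ?_) (by positivity)
  have hm : |y| - a * q ≤ max (|y| - a * q) 0 := le_max_left _ _
  obtain ⟨v, hv, hv'⟩ : ∃ v, |y| = b + v ∧ 0 ≤ v := ⟨|y| - b, by ring, by linarith⟩
  obtain ⟨δ, hδ, hδ'⟩ : ∃ v, b = a + v ∧ 0 ≤ v := ⟨b - a, by ring, by linarith⟩
  obtain ⟨p, hp, hp'⟩ : ∃ p, q = 1 - p ∧ τ / 2 ≤ p := ⟨1 - q, by ring, by linarith⟩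
  have hp0 : 0 ≤ p := by linarith
  have hsq : v ^ 2 + δ ^ 2 + δ * a * τ + a ^ 2 * p ^ 2 ≤ (max (|y| - a * q) 0) ^ 2 := by
    have : (δ + v + a * p) ^ 2 ≤ (max (|y| - a * q) 0) ^ 2 := by
      apply pow_le_pow_left₀ (by positivity)
      refine le_trans (le_of_eq ?_) hm
      rw [hv, hδ, hp]; ring
    have h5 : δ * a * (τ / 2) ≤ δ * a * p := by gcongr
    have h6 : 0 ≤ δ * v := by positivity
    have h7 : 0 ≤ v * (a * p) := by positivity
    nlinarith
  generalize max (|y| - a * q) 0 = m at hsq ⊢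
  rw [hv, hδ]
  have hnn : (n : ℝ) = a ^ 2 / 2 := by linarith
  rw [hnn]
  have := mul_le_mul_of_nonneg_left hg (sq_nonneg a)
  rw [hp] at this ⊢
  ring_nf at this hsq ⊢
  linarith
lemma phi_zero (y : ℝ) : |Real.exp (-y ^ 2 / 2) * hermiteH 0 y| ≤ Real.exp (-y ^ 2 / 2) := by
  rw [abs_mul, abs_of_pos (Real.exp_pos _)]
  apply mul_le_of_le_one_right (Real.exp_pos _).le
  unfold hermiteH
  have hpi : 1 ≤ Real.sqrt Real.pi := by
    rw [Real.one_le_sqrt]; linarith [Real.pi_gt_three]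
  simp only [pow_zero, Nat.factorial_zero, Nat.cast_one, one_mul, iteratedDeriv_zero]
  rw [mul_assoc, ← Real.exp_add, show y ^ 2 + -y ^ 2 = 0 by ring, Real.exp_zero, mul_one,
    abs_of_nonneg (by positivity)]
  apply inv_le_one_of_one_le₀
  rwa [Real.one_le_sqrt]

lemma phi_all (n M : ℕ) (hn : n ≤ M) (y ρ : ℝ) (hρ : 2 * ((M : ℝ) + 1) ≤ ρ ^ 2) (h0 : 0 < ρ) :
    |Real.exp (-y ^ 2 / 2) * hermiteH n y| ≤ 3 * ((M : ℝ) + 1) *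
      Real.exp (-(max (|y| - ρ) 0) ^ 2 / 2) := by
  have hnM : (n : ℝ) ≤ M := by exact_mod_cast hn
  have hM : (0 : ℝ) ≤ M := by positivity
  rcases Nat.eq_zero_or_pos n with rfl | hn1
  · refine (phi_zero y).trans ?_
    have : Real.exp (-y ^ 2 / 2) ≤ Real.exp (-(max (|y| - ρ) 0) ^ 2 / 2) := by
      rw [← sq_abs y]
      gcongr
      exact max_le (by linarith) (abs_nonneg _)
    nlinarith [Real.exp_pos (-(max (|y| - ρ) 0) ^ 2 / 2)]
  · refine (phi_bound2 n hn1 y 0).trans ?_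
    have ha : Real.sqrt (2 * n) ≤ ρ := by
      rw [Real.sqrt_le_left h0.le]; linarith
    simp only [neg_zero, Real.exp_zero, mul_one, mul_zero, one_pow]
    have h1 : (max (|y| - ρ) 0) ^ 2 ≤ (max (|y| - Real.sqrt (2 * n)) 0) ^ 2 := by
      gcongr
    gcongr
    · linarith
    · linarith

lemma phi_tail (n M : ℕ) (hn : n ≤ M) (y ρ θ : ℝ) (hθ0 : 0 < θ) (hθ1 : θ ≤ 2 / 3)
    (hρ : 2 * ((M : ℝ) + 1) + ((M : ℝ) + 1) ^ ((1 : ℝ) / 3 + θ) ≤ ρ ^ 2) (h0 : 0 < ρ)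
    (hy : ρ ≤ |y|) :
    |Real.exp (-y ^ 2 / 2) * hermiteH n y| ≤ 3 * ((M : ℝ) + 1) *
      (Real.exp (-(1 / 216) * ρ ^ (3 * θ)) * Real.exp (-(max (|y| - ρ) 0) ^ 2 / 2)) := by
  have hnM : (n : ℝ) ≤ M := by exact_mod_cast hn
  have hM : (0 : ℝ) ≤ M := by positivity
  rw [max_eq_left (by linarith), ← Real.exp_add]
  set N : ℝ := (M : ℝ) + 1 with hN
  have hN1 : 1 ≤ N := by linarith
  have hNp : 0 < N ^ ((1 : ℝ) / 3 + θ) := by positivity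
  have hρ1 : 1 ≤ ρ := by nlinarith
  have hX : ρ ^ (3 * θ) ≤ ρ ^ 2 := by
    rw [← Real.rpow_natCast]
    exact Real.rpow_le_rpow_of_exponent_le hρ1 (by push_cast; linarith)
  rcases Nat.eq_zero_or_pos n with rfl | hn1
  · refine (phi_zero y).trans ?_
    have : Real.exp (-y ^ 2 / 2) ≤ Real.exp (-(1 / 216) * ρ ^ (3 * θ) + -(|y| - ρ) ^ 2 / 2) := by
      gcongr
      rw [← sq_abs y]
      nlinarith
    nlinarith [Real.exp_pos (-(1 / 216) * ρ ^ (3 * θ) + -(|y| - ρ) ^ 2 / 2)]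
  have hn' : (1 : ℝ) ≤ n := by exact_mod_cast hn1
  have ha2 : (Real.sqrt (2 * n)) ^ 2 = 2 * n := Real.sq_sqrt (by positivity)
  have ha0 : 0 < Real.sqrt (2 * n) := by positivity
  have ha : Real.sqrt (2 * n) ≤ ρ := by
    rw [Real.sqrt_le_left h0.le]; linarith
  have hb := fun τ h0 h1 => phi_bound3 n hn1 y τ ρ h0 h1 ha hy
  set a := Real.sqrt (2 * n) with had
  rcases le_total (2 * a) ρ with hc | hc
  · refine (hb 0 le_rfl zero_le_one).trans ?_
    gcongr
    · linarith
    · nlinarith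
  · set τ : ℝ := N ^ (θ / 2 - 1 / 3) / 3 with hτ
    have hτ0 : 0 < τ := by positivity
    have hτ1 : N ^ (θ / 2 - 1 / 3) ≤ 1 := Real.rpow_le_one_of_one_le_of_nonpos hN1 (by linarith)
    refine (hb τ hτ0.le (by linarith)).trans ?_
    have hN0 : 0 < N := by linarith
    have e1 : N * τ ^ 3 = N ^ (3 * θ / 2) / 27 := by
      rw [hτ, div_pow, ← Real.rpow_natCast, ← Real.rpow_mul hN0.le, ← mul_div_assoc]
      nth_rw 1 [← Real.rpow_one N]
      rw [← Real.rpow_add hN0]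
      congr 2
      · push_cast; ring
      · norm_num
    have e2 : N ^ ((1 : ℝ) / 3 + θ) * τ = N ^ (3 * θ / 2) / 3 := by
      rw [hτ, ← mul_div_assoc, ← Real.rpow_add hN0]
      congr 2; ring
    have e3 : ρ ^ (3 * θ) ≤ 8 * N ^ (3 * θ / 2) := by
      have : ρ ^ (3 * θ) = (ρ ^ 2) ^ (3 * θ / 2) := by
        rw [← Real.rpow_natCast, ← Real.rpow_mul h0.le]; congr 1; push_cast; ring
      rw [this]
      calc (ρ ^ 2) ^ (3 * θ / 2) ≤ (8 * N) ^ (3 * θ / 2) := by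
            apply Real.rpow_le_rpow (by positivity) _ (by positivity)
            nlinarith
        _ = 8 ^ (3 * θ / 2) * N ^ (3 * θ / 2) := Real.mul_rpow (by norm_num) hN0.le
        _ ≤ 8 ^ (1 : ℝ) * N ^ (3 * θ / 2) := by
            gcongr
            · norm_num
            · linarith
        _ = _ := by rw [Real.rpow_one]
    have h3 : N ^ ((1 : ℝ) / 3 + θ) ≤ (ρ - a) * a * 3 := by
      have : N ^ ((1 : ℝ) / 3 + θ) ≤ (ρ - a) * (ρ + a) := by nlinarith
      nlinarith
    have h4 := mul_le_mul_of_nonneg_right h3 hτ0.le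
    have h5 : n * τ ^ 3 ≤ N * τ ^ 3 := by gcongr; linarith
    gcongr
    · linarith
    · nlinarith [sq_nonneg (ρ - a)]

lemma cauchy_dom (y ρ : ℝ) (hρ : 2 ≤ ρ ^ 2) (h0 : 0 < ρ) :
    Real.exp (-(max (|y| - ρ) 0) ^ 2 / 2) ≤ 5 * ρ ^ 2 * (1 + y ^ 2)⁻¹ := by
  set v := max (|y| - ρ) 0 with hv
  have hv0 : 0 ≤ v := le_max_right _ _
  have hv1 : |y| ≤ ρ + v := by linarith [le_max_left (|y| - ρ) 0]
  have hy : y ^ 2 ≤ (ρ + v) ^ 2 := by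
    rw [← sq_abs y]; gcongr
  have he : 1 + v ^ 2 / 2 ≤ Real.exp (v ^ 2 / 2) := by linarith [Real.add_one_le_exp (v ^ 2 / 2)]
  rw [neg_div, Real.exp_neg, inv_le_iff_one_le_mul₀ (Real.exp_pos _), ← div_eq_mul_inv,
    div_mul_eq_mul_div, one_le_div (by positivity)]
  calc 1 + y ^ 2 ≤ 5 * ρ ^ 2 * (1 + v ^ 2 / 2) := by nlinarith [sq_nonneg (ρ - v), mul_le_mul_of_nonneg_right hρ (sq_nonneg v)]
    _ ≤ _ := by gcongr

lemma psi_eq {d : ℕ} (i : Fin d → ℕ) (x : EuclideanSpace ℝ (Fin d)) :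
    hermitePsi i x = ∏ l, (Real.exp (-(x l) ^ 2 / 2) * hermiteH (i l) (x l)) := by
  unfold hermitePsi
  rw [Finset.prod_mul_distrib, ← Real.exp_sum, EuclideanSpace.norm_sq_eq]
  congr 2
  simp only [Real.norm_eq_abs, sq_abs]
  rw [← Finset.sum_div, Finset.sum_neg_distrib]

lemma psi_tail {d : ℕ} (i : Fin d → ℕ) (M : ℕ) (hi : ∀ l, i l ≤ M) (ρ θ : ℝ) (hθ0 : 0 < θ)
    (hθ1 : θ ≤ 2 / 3)
    (hρ : 2 * ((M : ℝ) + 1) + ((M : ℝ) + 1) ^ ((1 : ℝ) / 3 + θ) ≤ ρ ^ 2) (h0 : 0 < ρ)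
    (x : EuclideanSpace ℝ (Fin d)) (l : Fin d) (hx : ρ ≤ |x l|) :
    |hermitePsi i x| ≤ (15 * ρ ^ 4) ^ d * Real.exp (-(1 / 216) * ρ ^ (3 * θ)) *
      ∏ k, (1 + (x k) ^ 2)⁻¹ := by
  have hM : (0 : ℝ) ≤ M := by positivity
  have hNp : 0 < ((M : ℝ) + 1) ^ ((1 : ℝ) / 3 + θ) := by positivity
  have hall : ∀ k, |Real.exp (-(x k) ^ 2 / 2) * hermiteH (i k) (x k)| ≤
      (15 * ρ ^ 4) * (if k = l then Real.exp (-(1 / 216) * ρ ^ (3 * θ)) else 1) * (1 + (x k) ^ 2)⁻¹ := by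
    intro k
    have hd := cauchy_dom (x k) ρ (by linarith) h0
    have hM3 : 3 * ((M : ℝ) + 1) ≤ 3 * ρ ^ 2 := by linarith
    split_ifs with h
    · subst h
      refine (phi_tail (i k) M (hi k) (x k) ρ θ hθ0 hθ1 hρ h0 hx).trans ?_
      calc _ ≤ (3 * ρ ^ 2) * (Real.exp (-(1 / 216) * ρ ^ (3 * θ)) * (5 * ρ ^ 2 * (1 + (x k) ^ 2)⁻¹)) := by gcongr
        _ = _ := by ring
    · refine (phi_all (i k) M (hi k) (x k) ρ (by linarith) h0).trans ?_
      calc _ ≤ (3 * ρ ^ 2) * (5 * ρ ^ 2 * (1 + (x k) ^ 2)⁻¹) := by gcongr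
        _ = _ := by ring
  rw [psi_eq, Finset.abs_prod]
  refine (Finset.prod_le_prod (fun _ _ => abs_nonneg _) (fun k _ => hall k)).trans ?_
  rw [Finset.prod_mul_distrib, Finset.prod_mul_distrib, Finset.prod_ite_eq' univ l]
  simp

lemma G_int (d : ℕ) : Integrable (fun x : EuclideanSpace ℝ (Fin d) => ∏ k, (1 + (x k) ^ 2)⁻¹) ∧
    ∫ x : EuclideanSpace ℝ (Fin d), ∏ k, (1 + (x k) ^ 2)⁻¹ = Real.pi ^ d := by
  have hmp := PiLp.volume_preserving_ofLp (Fin d)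
  have hme : MeasurableEmbedding (@WithLp.ofLp 2 (Fin d → ℝ)) :=
    (MeasurableEquiv.toLp 2 (Fin d → ℝ)).symm.measurableEmbedding
  constructor
  · have h1 : Integrable (fun x : Fin d → ℝ => ∏ k, (1 + (x k) ^ 2)⁻¹) :=
      Integrable.fintype_prod (f := fun _ (t : ℝ) => (1 + t ^ 2)⁻¹) (fun _ => integrable_inv_one_add_sq)
    exact hmp.integrable_comp_of_integrable h1
  · have h2 := hmp.integral_comp hme (fun x : Fin d → ℝ => ∏ k, (1 + (x k) ^ 2)⁻¹)
    rw [h2, integral_fintype_prod_volume_eq_pow (fun t : ℝ => (1 + t ^ 2)⁻¹)]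
    simp

lemma poly_exp (p c : ℝ) (hp : 0 < p) (hc : 0 < c) (m : ℕ) :
    ∃ K : ℝ, 0 < K ∧ ∀ ρ : ℝ, 1 ≤ ρ → ρ ^ m ≤ K * Real.exp (c * ρ ^ p) := by
  obtain ⟨k, hk⟩ := exists_nat_ge ((m : ℝ) / p)
  refine ⟨k.factorial / c ^ k, by positivity, fun ρ hρ => ?_⟩
  have h0 : 0 < ρ := by linarith
  have h1 : ρ ^ m ≤ (ρ ^ p) ^ k := by
    rw [← Real.rpow_natCast, ← Real.rpow_natCast (ρ ^ p), ← Real.rpow_mul h0.le]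
    apply Real.rpow_le_rpow_of_exponent_le hρ
    rw [div_le_iff₀ hp] at hk; linarith
  have h2 := Real.pow_div_factorial_le_exp (c * ρ ^ p) (by positivity) k
  rw [div_le_iff₀ (by positivity), mul_pow] at h2
  rw [div_mul_eq_mul_div, le_div_iff₀ (by positivity)]
  have : ρ ^ m * c ^ k ≤ (ρ ^ p) ^ k * c ^ k := by gcongr
  linarith

/-- tails of Hermite functions. For `d ≥ 1` and `θ ∈ (0, 2/3]`,
there exist `0 < c, C < ∞`, depending only on `d` and `θ`, such that for every
nonempty finite `I ⊂ ℕ^d`, with `M_I` the largest coordinate appearing in `I`,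
every `ρ > √(2(M_I+1) + (M_I+1)^{1/3+θ})` and `W = [−ρ,ρ]^d`:
`sup_{i∈I} ‖ψ_i 1_{ℝ^d∖W}‖₁ + sup_{i∈I} ‖ψ_i 1_{ℝ^d∖W}‖₂² ≤ C e^{−c ρ^{3θ}}`. -/
theorem statement7 (d : ℕ) (hd : 1 ≤ d) (θ : ℝ) (hθ0 : 0 < θ) (hθ1 : θ ≤ 2 / 3) :
    ∃ c C : ℝ, 0 < c ∧ 0 < C ∧
      ∀ (I : Finset (Fin d → ℕ)) (hI : I.Nonempty) (M : ℕ),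
        M = I.sup' hI (fun i => Finset.univ.sup i) →
        ∀ ρ : ℝ,
          Real.sqrt (2 * ((M : ℝ) + 1) + ((M : ℝ) + 1) ^ ((1 : ℝ) / 3 + θ)) < ρ →
          (I.sup' hI fun i =>
              ∫ x in {x : EuclideanSpace ℝ (Fin d) | ∀ l, |x l| ≤ ρ}ᶜ, |hermitePsi i x|)
          + (I.sup' hI fun i =>
              ∫ x in {x : EuclideanSpace ℝ (Fin d) | ∀ l, |x l| ≤ ρ}ᶜ, hermitePsi i x ^ 2)
            ≤ C * Real.exp (-c * ρ ^ (3 * θ)) := by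
  obtain ⟨K, hK0, hK⟩ := poly_exp (3 * θ) (1 / 432) (by positivity) (by norm_num) (8 * d)
  refine ⟨1 / 432, 2 * Real.pi ^ d * 15 ^ (2 * d) * K, by norm_num, by positivity, ?_⟩
  intro I hI M hM ρ hρ
  have hMp : (0 : ℝ) ≤ M := by positivity
  have hNp : 0 < ((M : ℝ) + 1) ^ ((1 : ℝ) / 3 + θ) := by positivity
  have h0 : 0 < ρ := lt_of_le_of_lt (Real.sqrt_nonneg _) hρ
  have hρ2 : 2 * ((M : ℝ) + 1) + ((M : ℝ) + 1) ^ ((1 : ℝ) / 3 + θ) ≤ ρ ^ 2 :=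
    ((Real.sqrt_lt' h0).mp hρ).le
  have hρ1 : 1 ≤ ρ := by nlinarith
  have hi : ∀ i ∈ I, ∀ l, i l ≤ M := by
    intro i hiI l
    rw [hM]
    exact (Finset.le_sup (f := i) (Finset.mem_univ l)).trans
      (Finset.le_sup' (fun i : Fin d → ℕ => Finset.univ.sup i) hiI)
  set X := Real.exp (-(1 / 216) * ρ ^ (3 * θ)) with hX
  have hX0 : 0 < X := Real.exp_pos _
  have hX1 : X ≤ 1 := Real.exp_le_one_iff.mpr (by
    have : 0 < ρ ^ (3 * θ) := by positivity
    linarith)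
  set P := (15 * ρ ^ 4) ^ d with hP
  have hP1 : 1 ≤ P := one_le_pow₀ (by nlinarith [one_le_pow₀ hρ1 (n := 4)])
  obtain ⟨hGi, hGe⟩ := G_int d
  set W := {x : EuclideanSpace ℝ (Fin d) | ∀ l, |x l| ≤ ρ} with hW
  have hWm : MeasurableSet Wᶜ := by
    apply MeasurableSet.compl
    apply IsClosed.measurableSet
    rw [hW, Set.ofPred_forall]
    exact isClosed_iInter fun l => isClosed_le (by fun_prop) continuous_const
  have hG0 : ∀ x : EuclideanSpace ℝ (Fin d), 0 ≤ ∏ k, (1 + (x k) ^ 2)⁻¹ := fun x =>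
    Finset.prod_nonneg fun k _ => by positivity
  have hG1 : ∀ x : EuclideanSpace ℝ (Fin d), ∏ k, (1 + (x k) ^ 2)⁻¹ ≤ 1 := fun x =>
    Finset.prod_le_one (fun k _ => by positivity) fun k _ =>
      inv_le_one_of_one_le₀ (by nlinarith [sq_nonneg (x k)])
  have hpt : ∀ i ∈ I, ∀ x ∈ Wᶜ, |hermitePsi i x| ≤ P * X * ∏ k, (1 + (x k) ^ 2)⁻¹ := by
    intro i hiI x hx
    simp only [hW, Set.mem_compl_iff, Set.mem_ofPred_eq, not_forall, not_le] at hx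
    obtain ⟨l, hl⟩ := hx
    exact psi_tail i M (hi i hiI) ρ θ hθ0 hθ1 hρ2 h0 x l hl.le
  have hint : ∀ (f : EuclideanSpace ℝ (Fin d) → ℝ) (B : ℝ), 0 ≤ B → (∀ x, 0 ≤ f x) →
      (∀ x ∈ Wᶜ, f x ≤ B * ∏ k, (1 + (x k) ^ 2)⁻¹) → ∫ x in Wᶜ, f x ≤ B * Real.pi ^ d := by
    intro f B hB hf hfB
    calc ∫ x in Wᶜ, f x ≤ ∫ x in Wᶜ, B * ∏ k, (1 + (x k) ^ 2)⁻¹ := by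
          apply integral_mono_of_nonneg (Filter.Eventually.of_forall hf)
            (hGi.const_mul B).integrableOn
          exact (ae_restrict_iff' hWm).mpr (Filter.Eventually.of_forall hfB)
      _ ≤ ∫ x, B * ∏ k, (1 + ((x : EuclideanSpace ℝ (Fin d)) k) ^ 2)⁻¹ :=
          setIntegral_le_integral (hGi.const_mul B)
            (Filter.Eventually.of_forall fun x => mul_nonneg hB (hG0 x))
      _ = B * Real.pi ^ d := by rw [integral_const_mul, hGe]
  have hPX : P * X ≤ P ^ 2 * X := by gcongr; nlinarith
  have hA : (I.sup' hI fun i => ∫ x in Wᶜ, |hermitePsi i x|) ≤ P ^ 2 * X * Real.pi ^ d := by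
    apply Finset.sup'_le
    intro i hiI
    refine hint _ _ (by positivity) (fun x => abs_nonneg _) fun x hx => (hpt i hiI x hx).trans ?_
    exact mul_le_mul_of_nonneg_right hPX (hG0 x)
  have hB : (I.sup' hI fun i => ∫ x in Wᶜ, hermitePsi i x ^ 2) ≤ P ^ 2 * X * Real.pi ^ d := by
    apply Finset.sup'_le
    intro i hiI
    refine hint _ _ (by positivity) (fun x => sq_nonneg _) fun x hx => ?_
    have h1 := hpt i hiI x hx
    have hg0 := hG0 x
    have hg1 := hG1 x
    set g := ∏ k, (1 + (x k) ^ 2)⁻¹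
    rw [← sq_abs]
    calc |hermitePsi i x| ^ 2 ≤ (P * X * g) ^ 2 := by gcongr
      _ = P ^ 2 * (X * X) * (g * g) := by ring
      _ ≤ P ^ 2 * (X * 1) * (g * 1) := by gcongr
      _ = _ := by ring
  have hP2 : P ^ 2 = 15 ^ (2 * d) * ρ ^ (8 * d) := by
    rw [hP, ← pow_mul, mul_pow, ← pow_mul, mul_comm d 2]; congr 2; ring
  have hXX : Real.exp (1 / 432 * ρ ^ (3 * θ)) * X = Real.exp (-(1 / 432) * ρ ^ (3 * θ)) := by
    rw [hX, ← Real.exp_add]; congr 1; ring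
  calc _ ≤ P ^ 2 * X * Real.pi ^ d + P ^ 2 * X * Real.pi ^ d := add_le_add hA hB
    _ = 2 * Real.pi ^ d * 15 ^ (2 * d) * ρ ^ (8 * d) * X := by rw [hP2]; ring
    _ ≤ 2 * Real.pi ^ d * 15 ^ (2 * d) * (K * Real.exp (1 / 432 * ρ ^ (3 * θ))) * X := by
      gcongr
      exact hK ρ hρ1
    _ = _ := by rw [← hXX]; ring
end

section
/- Let m ≥ 1 and Λ ≥ 1 be integers and let a, b ≥ 0 be reals. Let 𝒩 and Γ be independent real random variables, where 𝒩 has the standard Gaussian distribution N(0,1) and Γ has the Gamma distribution of shape Λ and rate 1. Then E[ ( a𝒩 + b(Γ − Λ) )^{2m} ] ≤ (2m)! · 2^{m−1} · ( a^{2m} / (2^m m!) + (bΛ)^{2m} ). -/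
open MeasureTheory ProbabilityTheory


lemma key_fact {k m : ℕ} (h : k ≤ m) : (k.factorial) ^ m ≤ (m.factorial) ^ k := by
  have h1 := Nat.factorial_mul_pow_sub_le_factorial h
  have h2 : k.factorial ≤ k ^ k := Nat.factorial_le_pow k
  calc k.factorial ^ m = k.factorial ^ k * k.factorial ^ (m - k) := by
        rw [← pow_add]; congr 1; omega
    _ ≤ k.factorial ^ k * (k ^ k) ^ (m - k) := by gcongr
    _ = (k.factorial * k ^ (m - k)) ^ k := by rw [mul_pow, ← pow_mul, ← pow_mul, mul_comm k]
    _ ≤ _ := by gcongr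

lemma gauss_int (n : ℕ) : Integrable (fun x : ℝ => x ^ n) (gaussianReal 0 1) := by
  have := (memLp_id_gaussianReal (μ := 0) (v := 1) n)
  have h := this.integrable_norm_pow'
  refine h.congr' (by fun_prop) ?_
  filter_upwards with x; simp

lemma gauss_int' (n : ℕ) : Integrable (fun x : ℝ => x ^ n * gaussianPDFReal 0 1 x) := by
  have h := gauss_int n
  rw [gaussianReal_of_var_ne_zero _ one_ne_zero, integrable_withDensity_iff (by fun_prop) (by simp [gaussianPDF])] at h
  refine h.congr ?_
  filter_upwards with x
  simp [gaussianPDF, gaussianPDFReal_nonneg]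

lemma gauss_rec (n : ℕ) : ∫ x, x ^ (n + 2) ∂(gaussianReal 0 1) = (n + 1) * ∫ x, x ^ n ∂(gaussianReal 0 1) := by
  have hd : ∀ x : ℝ, HasDerivAt (fun x => x ^ (n + 1) * gaussianPDFReal 0 1 x)
      ((n + 1) * (x ^ n * gaussianPDFReal 0 1 x) - x ^ (n + 2) * gaussianPDFReal 0 1 x) x := by
    intro x
    have h1 : HasDerivAt (fun x : ℝ => -(x - 0) ^ 2 / (2 * ((1 : NNReal) : ℝ))) (-x) x := by
      have := (((hasDerivAt_id x).pow 2).neg).div_const 2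
      convert this using 1 <;> first | (ext y; simp; done) | (simp; done) | (simp; ring)
    have h2 : HasDerivAt (gaussianPDFReal 0 1) (gaussianPDFReal 0 1 x * (-x)) x := by
      have := h1.exp.const_mul (√(2 * Real.pi * ((1 : NNReal) : ℝ)))⁻¹
      rw [← mul_assoc] at this
      exact this
    refine ((hasDerivAt_pow (n + 1) x).mul h2).congr_deriv ?_
    push_cast [Nat.add_sub_cancel]
    ring
  have i1 := (gauss_int' n).const_mul ((n : ℝ) + 1)
  have i2 := gauss_int' (n + 2)
  have := integral_eq_zero_of_hasDerivAt_of_integrable hd (i1.sub i2) (gauss_int' (n + 1))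
  rw [integral_sub i1 i2, integral_const_mul] at this
  rw [integral_gaussianReal_eq_integral_smul one_ne_zero, integral_gaussianReal_eq_integral_smul one_ne_zero]
  simp only [smul_eq_mul, mul_comm (gaussianPDFReal 0 1 _)]
  linarith

lemma gauss_odd (j : ℕ) : ∫ x, x ^ (2 * j + 1) ∂(gaussianReal 0 1) = 0 := by
  induction j with
  | zero => simp
  | succ j ih => rw [show 2 * (j + 1) + 1 = (2 * j + 1) + 2 by ring, gauss_rec, ih, mul_zero]

lemma gauss_even (j : ℕ) : ∫ x, x ^ (2 * j) ∂(gaussianReal 0 1) =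
    ((2 * j).factorial : ℝ) / (2 ^ j * j.factorial) := by
  induction j with
  | zero => simp
  | succ j ih =>
    rw [show 2 * (j + 1) = (2 * j) + 2 by ring, gauss_rec, ih, Nat.factorial_succ, Nat.factorial_succ, Nat.factorial_succ]
    push_cast
    field_simp
    ring

/-- analytic inequality -/
lemma final_ineq (m : ℕ) (hm : 1 ≤ m) (x y : ℝ) (hx : 0 ≤ x) (hy : 0 ≤ y) :
    ∑ j ∈ Finset.range (m + 1), x ^ j / j.factorial * y ^ (m - j) ≤
      2 ^ (m - 1) * (x ^ m / m.factorial + y ^ m) := by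
  obtain ⟨c, hc, hcm⟩ : ∃ c : ℝ, 0 < c ∧ c ^ m = m.factorial := by
    refine ⟨(m.factorial : ℝ) ^ ((m : ℝ)⁻¹), by positivity, ?_⟩
    exact Real.rpow_inv_natCast_pow (by positivity) (by omega)
  have hk : ∀ k ≤ m, (k.factorial : ℝ) ≤ c ^ k := by
    intro k hk
    have := key_fact hk
    refine le_of_pow_le_pow_left₀ (n := m) (by omega) (by positivity) ?_
    rw [← pow_mul, mul_comm, pow_mul, hcm]
    exact_mod_cast this
  have h1 : ∑ j ∈ Finset.range (m + 1), x ^ j / j.factorial * y ^ (m - j) ≤ (x / c + y) ^ m := by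
    rw [add_pow]
    refine Finset.sum_le_sum fun j hj => ?_
    have hj : j ≤ m := by simpa [Nat.lt_succ_iff] using hj
    have e : (m.choose j : ℝ) = m.factorial / (j.factorial * (m - j).factorial) := by
      rw [Nat.cast_choose ℝ hj]
    have h2 := hk (m - j) (by omega)
    have h3 : (1 : ℝ) / j.factorial ≤ m.choose j / c ^ j := by
      rw [e, ← hcm, ← Nat.sub_add_cancel hj, pow_add, Nat.sub_add_cancel hj, div_div, div_le_div_iff₀ (by positivity) (by positivity)]
      have : (0:ℝ) ≤ j.factorial * c ^ j := by positivity
      nlinarith [mul_le_mul_of_nonneg_left h2 this]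
    calc x ^ j / j.factorial * y ^ (m - j) = (x ^ j * y ^ (m - j)) * (1 / j.factorial) := by ring
      _ ≤ (x ^ j * y ^ (m - j)) * (m.choose j / c ^ j) := by gcongr
      _ = _ := by rw [div_pow]; ring
  refine h1.trans ((add_pow_le (by positivity) hy m).trans_eq ?_)
  rw [div_pow, hcm]

lemma gamma_congr {a : ℝ} (ha : 0 < a) (k : ℕ) (x : ℝ) (hx : x ∈ Set.Ioi (0:ℝ)) :
    x ^ k * gammaPDFReal a 1 x = (Real.Gamma a)⁻¹ * (Real.exp (-x) * x ^ (a + k - 1)) := by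
  have hx : 0 < x := hx
  have : x ^ (a + k - 1) = x ^ k * x ^ (a - 1) := by
    rw [← Real.rpow_natCast, ← Real.rpow_add hx]; congr 1; ring
  rw [gammaPDFReal, if_pos hx.le, this]
  simp
  ring

lemma gamma_intOn {a : ℝ} (ha : 0 < a) (k : ℕ) :
    IntegrableOn (fun x : ℝ => x ^ k * gammaPDFReal a 1 x) (Set.Ioi 0) := by
  have h := (Real.GammaIntegral_convergent (s := a + k) (by positivity)).const_mul (Real.Gamma a)⁻¹
  exact (IntegrableOn.congr_fun h (fun x hx => (gamma_congr ha k x hx).symm) measurableSet_Ioi)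

lemma gamma_zero {a : ℝ} (k : ℕ) : ∀ x ∉ Set.Ici (0:ℝ), x ^ k * gammaPDFReal a 1 x = 0 := by
  intro x hx
  rw [gammaPDFReal, if_neg (by simpa using hx), mul_zero]

lemma gamma_int' {a : ℝ} (ha : 0 < a) (k : ℕ) :
    Integrable (fun x : ℝ => x ^ k * gammaPDFReal a 1 x) := by
  rw [← integrableOn_iff_integrable_of_support_subset (s := Set.Ici 0), integrableOn_Ici_iff_integrableOn_Ioi]
  · exact gamma_intOn ha k
  · intro x hx
    by_contra h
    exact hx (gamma_zero k x h)

lemma gamma_int {a : ℝ} (ha : 0 < a) (k : ℕ) :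
    Integrable (fun x : ℝ => x ^ k) (gammaMeasure a 1) := by
  rw [gammaMeasure, integrable_withDensity_iff (by unfold gammaPDF; fun_prop) (by simp [gammaPDF])]
  refine (gamma_int' ha k).congr ?_
  filter_upwards with x
  simp [gammaPDF, gammaPDFReal_nonneg ha one_pos]

lemma gamma_moment {a : ℝ} (ha : 0 < a) (k : ℕ) :
    ∫ x, x ^ k ∂(gammaMeasure a 1) = (Real.Gamma a)⁻¹ * Real.Gamma (a + k) := by
  rw [gammaMeasure, integral_withDensity_eq_integral_toReal_smul (by unfold gammaPDF; fun_prop) (by simp [gammaPDF])]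
  have : ∀ x, (gammaPDF a 1 x).toReal • x ^ k = x ^ k * gammaPDFReal a 1 x := by
    intro x; simp [gammaPDF, gammaPDFReal_nonneg ha one_pos, mul_comm]
  simp_rw [this]
  rw [← setIntegral_eq_integral_of_forall_compl_eq_zero (gamma_zero k), integral_Ici_eq_integral_Ioi,
    setIntegral_congr_fun measurableSet_Ioi (gamma_congr ha k), integral_const_mul, Real.Gamma_eq_integral (s := a + k) (by positivity)]

open Polynomial in
lemma gamma_poly_int {a : ℝ} (ha : 0 < a) (p : ℝ[X]) :
    Integrable (fun x : ℝ => p.eval x) (gammaMeasure a 1) := by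
  simp_rw [eval_eq_sum_range]
  exact integrable_finsetSum _ fun i _ => (gamma_int ha i).const_mul _

open Polynomial in
lemma gamma_stein {a : ℝ} (ha : 0 < a) (p : ℝ[X]) :
    ∫ x, ((X - C a) * p).eval x ∂(gammaMeasure a 1) = ∫ x, (X * derivative p).eval x ∂(gammaMeasure a 1) := by
  induction p using Polynomial.induction_on' with
  | add p q hp hq =>
    simp only [derivative_add, mul_add, eval_add] at *
    rw [integral_add (gamma_poly_int ha _) (gamma_poly_int ha _), integral_add (gamma_poly_int ha _) (gamma_poly_int ha _), hp, hq]
  | monomial n c =>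
    have e1 : ∀ x : ℝ, ((X - C a) * monomial n c).eval x = c * x ^ (n + 1) - (c * a) * x ^ n := by
      intro x; simp; ring
    have e2 : ∀ x : ℝ, (X * derivative (monomial n c)).eval x = (c * n) * x ^ n := by
      intro x; rcases n with _ | n
      · simp
      · simp
    simp_rw [e1, e2]
    rw [integral_sub ((gamma_int ha _).const_mul _) ((gamma_int ha _).const_mul _)]
    simp_rw [integral_const_mul]
    rw [gamma_moment ha, gamma_moment ha]
    push_cast
    rw [← add_assoc, Real.Gamma_add_one (by positivity)]
    ring

lemma gamma_cent_int {a : ℝ} (ha : 0 < a) (n : ℕ) :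
    Integrable (fun x : ℝ => (x - a) ^ n) (gammaMeasure a 1) := by
  refine (gamma_poly_int ha ((Polynomial.X - Polynomial.C a) ^ n)).congr ?_
  filter_upwards with x
  simp [Polynomial.eval_pow]

lemma gamma_rec {a : ℝ} (ha : 0 < a) (n : ℕ) :
    ∫ x, (x - a) ^ (n + 2) ∂(gammaMeasure a 1) =
      (n + 1) * (∫ x, (x - a) ^ (n + 1) ∂(gammaMeasure a 1) + a * ∫ x, (x - a) ^ n ∂(gammaMeasure a 1)) := by
  have h := gamma_stein ha ((Polynomial.X - Polynomial.C a) ^ (n + 1))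
  rw [← integral_const_mul, ← integral_add (gamma_cent_int ha _) ((gamma_cent_int ha _).const_mul _), ← integral_const_mul]
  refine Eq.trans (integral_congr_ae ?_) (h.trans (integral_congr_ae ?_))
  · filter_upwards with x; simp [Polynomial.eval_pow]; ring
  · filter_upwards with x; simp [Polynomial.derivative_pow, Polynomial.eval_pow]; ring

lemma gamma_one {a : ℝ} (ha : 0 < a) : ∫ x, (x - a) ^ 1 ∂(gammaMeasure a 1) = 0 := by
  simpa using gamma_stein ha 1

lemma gamma_bound {a : ℝ} (ha : 1 ≤ a) (n : ℕ) :
    (0 ≤ ∫ x, (x - a) ^ n ∂(gammaMeasure a 1) ∧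
    ∫ x, (x - a) ^ n ∂(gammaMeasure a 1) ≤ n.factorial * a ^ n) ∧
    (0 ≤ ∫ x, (x - a) ^ (n + 1) ∂(gammaMeasure a 1) ∧
    ∫ x, (x - a) ^ (n + 1) ∂(gammaMeasure a 1) ≤ (n + 1).factorial * a ^ (n + 1)) := by
  have ha0 : 0 < a := by linarith
  induction n with
  | zero =>
    have := isProbabilityMeasure_gammaMeasure ha0 one_pos
    rw [gamma_one ha0]
    simp [ha0.le]
  | succ n ih =>
    refine ⟨ih.2, ?_⟩
    obtain ⟨⟨h1, h2⟩, h3, h4⟩ := ih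
    rw [show n + 1 + 1 = n + 2 by rfl, gamma_rec ha0]
    refine ⟨by positivity, ?_⟩
    calc _ ≤ ((n:ℝ) + 1) * ((n + 1).factorial * a ^ (n + 1) + a * (n.factorial * a ^ n)) := by gcongr
      _ = (n + 2).factorial * a ^ (n + 1) * 1 := by
        simp only [Nat.factorial_succ]; push_cast; ring
      _ ≤ (n + 2).factorial * a ^ (n + 1) * a := by gcongr
      _ = _ := by ring

lemma sum_even (f : ℕ → ℝ) (hf : ∀ j, f (2 * j + 1) = 0) (m : ℕ) :
    ∑ i ∈ Finset.range (2 * m + 1), f i = ∑ j ∈ Finset.range (m + 1), f (2 * j) := by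
  induction m with
  | zero => simp
  | succ m ih =>
    rw [Finset.sum_range_succ _ (m + 1), ← ih, show 2 * (m + 1) + 1 = 2 * m + 1 + 1 + 1 by ring,
      Finset.sum_range_succ, Finset.sum_range_succ, hf]
    simp [mul_add]

/-- If `𝒩 ~ N(0,1)` and `Γ ~ Gamma(Λ,1)` are independent, with
`Λ ≥ 1` an integer, `m ≥ 1`, and `a, b ≥ 0`, then
`E[(a𝒩 + b(Γ−Λ))^{2m}] ≤ (2m)! · 2^{m−1} · (a^{2m}/(2^m m!) + (bΛ)^{2m})`. -/
theorem statement12 (m Λ : ℕ) (hm : 1 ≤ m) (hΛ : 1 ≤ Λ)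
    (a b : ℝ) (ha : 0 ≤ a) (hb : 0 ≤ b)
    {Ω : Type*} [MeasurableSpace Ω] (μ : Measure Ω) [IsProbabilityMeasure μ]
    (N G : Ω → ℝ) (hN : Measurable N) (hG : Measurable G)
    (hindep : IndepFun N G μ)
    (hNd : μ.map N = gaussianReal 0 1) (hGd : μ.map G = gammaMeasure Λ 1) :
    ∫ ω, (a * N ω + b * (G ω - Λ)) ^ (2 * m) ∂μ ≤
      (Nat.factorial (2 * m) : ℝ) * 2 ^ (m - 1) *
        (a ^ (2 * m) / (2 ^ m * (Nat.factorial m : ℝ)) + (b * Λ) ^ (2 * m)) := by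
  have hΛ1 : (1 : ℝ) ≤ Λ := by exact_mod_cast hΛ
  have hΛ0 : (0 : ℝ) < Λ := by linarith
  have iN : ∀ i : ℕ, Integrable (fun ω => N ω ^ i) μ := by
    intro i
    have h := gauss_int i
    rw [← hNd] at h
    exact h.comp_measurable hN
  have iG : ∀ i : ℕ, Integrable (fun ω => (G ω - Λ) ^ i) μ := by
    intro i
    have h := gamma_cent_int hΛ0 i
    rw [← hGd] at h
    exact h.comp_measurable hG
  have eN : ∀ i : ℕ, ∫ ω, N ω ^ i ∂μ = ∫ x, x ^ i ∂(gaussianReal 0 1) := by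
    intro i
    rw [← hNd, integral_map hN.aemeasurable (by fun_prop)]
  have eG : ∀ i : ℕ, ∫ ω, (G ω - Λ) ^ i ∂μ = ∫ x, (x - Λ) ^ i ∂(gammaMeasure Λ 1) := by
    intro i
    rw [← hGd, integral_map hG.aemeasurable (by fun_prop)]
  have iNG : ∀ i j : ℕ, Integrable (fun ω => N ω ^ i * (G ω - Λ) ^ j) μ := by
    intro i j
    have h : IndepFun (fun ω => N ω ^ i) (fun ω => (G ω - Λ) ^ j) μ :=
      hindep.comp (φ := fun x : ℝ => x ^ i) (ψ := fun x : ℝ => (x - Λ) ^ j) (by fun_prop) (by fun_prop)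
    exact h.integrable_mul (iN i) (iG j)
  have eNG : ∀ i j : ℕ, ∫ ω, N ω ^ i * (G ω - Λ) ^ j ∂μ =
      (∫ x, x ^ i ∂(gaussianReal 0 1)) * ∫ x, (x - Λ) ^ j ∂(gammaMeasure Λ 1) := by
    intro i j
    rw [← eN, ← eG]
    exact hindep.integral_fun_comp_mul_comp (f := fun x : ℝ => x ^ i) (g := fun x : ℝ => (x - Λ) ^ j)
      hN.aemeasurable hG.aemeasurable (by fun_prop) (by fun_prop)
  have hexp : ∀ ω, (a * N ω + b * (G ω - Λ)) ^ (2 * m) = ∑ i ∈ Finset.range (2 * m + 1),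
      (a ^ i * b ^ (2 * m - i) * (2 * m).choose i) * (N ω ^ i * (G ω - Λ) ^ (2 * m - i)) := by
    intro ω
    rw [add_pow]
    refine Finset.sum_congr rfl fun i _ => ?_
    rw [mul_pow, mul_pow]; ring
  simp_rw [hexp]
  rw [integral_finsetSum _ (fun i _ => (iNG _ _).const_mul _)]
  simp_rw [integral_const_mul, eNG]
  rw [sum_even _ (fun j => by rw [gauss_odd]; ring)]
  have hfin := final_ineq m hm (a ^ 2 / 2) ((b * Λ) ^ 2) (by positivity) (by positivity)
  calc _ ≤ ∑ j ∈ Finset.range (m + 1), ((2 * m).factorial : ℝ) *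
        ((a ^ 2 / 2) ^ j / j.factorial * ((b * Λ) ^ 2) ^ (m - j)) := by
        refine Finset.sum_le_sum fun j hj => ?_
        have hj : j ≤ m := by simpa [Nat.lt_succ_iff] using hj
        rw [gauss_even, Nat.cast_choose ℝ (by omega : 2 * j ≤ 2 * m)]
        have hb2 := (gamma_bound hΛ1 (2 * m - 2 * j)).1.2
        calc _ ≤ a ^ (2 * j) * b ^ (2 * m - 2 * j) *
              (((2 * m).factorial : ℝ) / ((2 * j).factorial * (2 * m - 2 * j).factorial)) *
              (((2 * j).factorial : ℝ) / (2 ^ j * j.factorial) *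
                ((2 * m - 2 * j).factorial * (Λ : ℝ) ^ (2 * m - 2 * j))) := by gcongr
          _ = _ := by
            rw [← pow_mul, div_pow, ← pow_mul, Nat.mul_sub, mul_pow]
            field_simp
    _ = ((2 * m).factorial : ℝ) * ∑ j ∈ Finset.range (m + 1),
        ((a ^ 2 / 2) ^ j / j.factorial * ((b * Λ) ^ 2) ^ (m - j)) := by rw [Finset.mul_sum]
    _ ≤ ((2 * m).factorial : ℝ) * (2 ^ (m - 1) *
        ((a ^ 2 / 2) ^ m / m.factorial + ((b * Λ) ^ 2) ^ m)) := by gcongr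
    _ = _ := by
      rw [← pow_mul, div_pow, ← pow_mul, div_div]; ring
end
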